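/- Let μ be a Borel probability measure on Ω⁺ invariant under the shift S, and for n ∈ ℕ let E_n = {μ(C_u) : u ∈ L(Ω), |u| = n}. Then: (i) E_1 = {λ^{−(d−1+k)} : 0 ≤ k ≤ d−1}; (ii) for every n ≥ 2, if the prefix of ω of length n−1 is right-special, then there exists j ∈ ℕ with E_n = {λ^{−(j+k)} : 0 ≤ k ≤ 2d−3}, and otherwise there exists j ∈ ℕ with E_n = {λ^{−(j+k)} : 0 ≤ k ≤ 2d−2}. -/

import Mathlib

/-- The substitution σ on the alphabet A = {1, …, d}:
σ(1) = 12, σ(k) = k+1 for 2 ≤ k ≤ d−1, σ(d) = 1. Letters are literal natural numbers. -/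
def sig (d : ℕ) (a : ℕ) : List ℕ :=
  if a = 1 then [1, 2] else if a = d then [1] else [a + 1]

/-- Extension of a substitution to finite words by concatenation. -/
def applySub (f : ℕ → List ℕ) : List ℕ → List ℕ
  | [] => []
  | a :: w => f a ++ applySub f w

/-- σⁿ applied to a word. -/
def sigIter (d n : ℕ) (w : List ℕ) : List ℕ := (applySub (sig d))^[n] w

/-- The language L(Ω): the set of finite factors of the fixed point ω, i.e. of the
words σⁿ(1). -/
def Lang (d : ℕ) (u : List ℕ) : Prop := ∃ n : ℕ, u <:+: sigIter d n [1]

/-- `w` is a (finite) prefix of the infinite word `V`. -/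
def PrefixOfInf (w : List ℕ) (V : ℕ → ℕ) : Prop :=
  ∀ (i : ℕ) (h : i < w.length), w.get ⟨i, h⟩ = V i

/-- `ω` is the fixed point of σ: the unique infinite word admitting every σⁿ(1) as a
prefix. -/
def IsSigmaFixedPoint (d : ℕ) (ω : ℕ → ℕ) : Prop :=
  ∀ n : ℕ, PrefixOfInf (sigIter d n [1]) ω

/-- `u` is left-special: there are distinct letters a, b ∈ A with au, bu ∈ L(Ω). -/
def LeftSpecial (d : ℕ) (u : List ℕ) : Prop :=
  ∃ a b : ℕ, a ≠ b ∧ 1 ≤ a ∧ a ≤ d ∧ 1 ≤ b ∧ b ≤ d ∧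
    Lang d (a :: u) ∧ Lang d (b :: u)

/-- `u` is right-special: there are distinct letters a, b ∈ A with ua, ub ∈ L(Ω). -/
def RightSpecial (d : ℕ) (u : List ℕ) : Prop :=
  ∃ a b : ℕ, a ≠ b ∧ 1 ≤ a ∧ a ≤ d ∧ 1 ≤ b ∧ b ≤ d ∧
    Lang d (u ++ [a]) ∧ Lang d (u ++ [b])

/-- `u` is bispecial: both left- and right-special. -/
def Bispecial (d : ℕ) (u : List ℕ) : Prop := LeftSpecial d u ∧ RightSpecial d u

/-- The shift S on infinite words. -/
def shiftMap (V : ℕ → ℕ) : ℕ → ℕ := fun i => V (i + 1)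

/-- Ω⁺ : the closure (for the product topology, letters discrete) of the shift
orbit of ω. -/
def OmegaPlus (ω : ℕ → ℕ) : Set (ℕ → ℕ) :=
  closure {V : ℕ → ℕ | ∃ n : ℕ, V = shiftMap^[n] ω}

/-- The cylinder C_u = {V ∈ Ω⁺ : u is a prefix of V}. -/
def Cyl (ω : ℕ → ℕ) (u : List ℕ) : Set (ℕ → ℕ) :=
  {V | V ∈ OmegaPlus ω ∧ PrefixOfInf u V}

/-- Prepending a letter to an infinite word. -/
def consInf (a : ℕ) (V : ℕ → ℕ) : ℕ → ℕ :=
  fun i => match i with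
  | 0 => a
  | j + 1 => V j

/-- Extension of σ to infinite words: σ(V) = σ(V₀)σ(V₁)σ(V₂)⋯ (each σ(a) is a
nonempty word, so the n-th letter of σ(V) is the n-th letter of σ(V₀…Vₙ)). -/
def sigInf (d : ℕ) (V : ℕ → ℕ) : ℕ → ℕ :=
  fun n => (applySub (sig d) ((List.range (n + 1)).map V)).getD n 0

/-- Concatenation of a finite list of words. -/
def concatAll : List (List ℕ) → List ℕ
  | [] => []
  | w :: ws => w ++ concatAll ws

/-- The set E_n of values of μ on cylinders of words of length n in L(Ω). -/
noncomputable def cylValues (ω : ℕ → ℕ) (μ : MeasureTheory.Measure (ℕ → ℕ))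
    (d n : ℕ) : Set ℝ :=
  {x | ∃ u : List ℕ, Lang d u ∧ u.length = n ∧ (μ (Cyl ω u)).toReal = x}

/-! ### Combinatorics of the substitution -/

theorem applySub_append (f : ℕ → List ℕ) (u v : List ℕ) :
    applySub f (u ++ v) = applySub f u ++ applySub f v := by
  induction u with
  | nil => rfl
  | cons a u ih => simp [applySub, ih]

theorem applySub_singleton (f : ℕ → List ℕ) (a : ℕ) : applySub f [a] = f a := by
  simp [applySub]

theorem sig_ne_nil (d a : ℕ) : sig d a ≠ [] := by
  unfold sig; split_ifs <;> simp

theorem length_le_length_applySub_sig (d : ℕ) (w : List ℕ) :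
    w.length ≤ (applySub (sig d) w).length := by
  induction w with
  | nil => simp
  | cons a w ih =>
    have : 0 < (sig d a).length := List.length_pos_iff.2 (sig_ne_nil d a)
    simp only [applySub, List.length_append, List.length_cons]
    omega

theorem sigIter_succ (d n : ℕ) (w : List ℕ) :
    sigIter d (n + 1) w = applySub (sig d) (sigIter d n w) :=
  Function.iterate_succ_apply' _ _ _

theorem sigIter_append (d n : ℕ) (u v : List ℕ) :
    sigIter d n (u ++ v) = sigIter d n u ++ sigIter d n v := by
  induction n with
  | zero => rfl
  | succ n ih => rw [sigIter_succ, ih, applySub_append, ← sigIter_succ, ← sigIter_succ]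

theorem length_le_length_sigIter (d n : ℕ) (w : List ℕ) :
    w.length ≤ (sigIter d n w).length := by
  induction n with
  | zero => exact le_rfl
  | succ n ih =>
    rw [sigIter_succ]
    exact ih.trans (length_le_length_applySub_sig d _)

theorem sigIter_succ_one (d n : ℕ) :
    sigIter d (n + 1) [1] = sigIter d n [1] ++ sigIter d n [2] := by
  rw [← sigIter_append]
  simp [sigIter, applySub, sig]

theorem lt_length_sigIter_one (d n : ℕ) : n < (sigIter d n [1]).length := by
  induction n with
  | zero => simp [sigIter]
  | succ n ih =>
    have := length_le_length_sigIter d n [2]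
    rw [sigIter_succ_one, List.length_append]
    simp only [List.length_singleton] at this
    omega

/-- The pairs of letters which may be adjacent in a word of the language. -/
def AdjPair (d a b : ℕ) : Prop := 1 ≤ a ∧ a ≤ d ∧ (b = 1 ∨ b = a + 1 ∧ a < d)

theorem mem_applySub_sig_bounds {d : ℕ} (hd : 3 ≤ d) {w : List ℕ}
    (hw : ∀ a ∈ w, 1 ≤ a ∧ a ≤ d) : ∀ a ∈ applySub (sig d) w, 1 ≤ a ∧ a ≤ d := by
  induction w with
  | nil => simp [applySub]
  | cons b w ih =>
    intro a ha
    rw [applySub, List.mem_append] at ha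
    rcases ha with ha | ha
    · have := hw b (by simp)
      unfold sig at ha
      split_ifs at ha <;> simp at ha <;> omega
    · exact ih (fun a h => hw a (by simp [h])) a ha

theorem mem_sigIter_bounds {d : ℕ} (hd : 3 ≤ d) (n : ℕ) :
    ∀ a ∈ sigIter d n [1], 1 ≤ a ∧ a ≤ d := by
  induction n with
  | zero => simp [sigIter]; omega
  | succ n ih => rw [sigIter_succ]; exact mem_applySub_sig_bounds hd ih

theorem isChain_applySub_sig {d : ℕ} (hd : 3 ≤ d) {w : List ℕ}
    (hw : w.IsChain (AdjPair d)) (hb : ∀ a ∈ w, 1 ≤ a ∧ a ≤ d) :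
    (applySub (sig d) w).IsChain (AdjPair d) := by
  induction w with
  | nil => simp [applySub]
  | cons a w ih =>
    have ih' := ih hw.tail (fun a h => hb a (by simp [h]))
    rw [applySub, List.isChain_append]
    refine ⟨?_, ih', ?_⟩
    · unfold sig; split_ifs <;> simp [AdjPair]; omega
    · intro x hx y hy
      cases w with
      | nil => simp [applySub] at hy
      | cons b w =>
        have h1 : AdjPair d a b := by
          rw [List.isChain_cons_cons] at hw; exact hw.1
        have ha := hb a (by simp)
        unfold AdjPair at h1 ⊢
        simp only [applySub, sig] at hx hy
        split_ifs at hx hy <;> simp at hx hy <;> omega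

theorem isChain_sigIter {d : ℕ} (hd : 3 ≤ d) (n : ℕ) :
    (sigIter d n [1]).IsChain (AdjPair d) := by
  induction n with
  | zero => simp [sigIter]
  | succ n ih => rw [sigIter_succ]; exact isChain_applySub_sig hd ih (mem_sigIter_bounds hd n)

theorem Lang.of_infix {d : ℕ} {u v : List ℕ} (h : Lang d v) (huv : u <:+: v) : Lang d u :=
  h.imp fun _ hn => huv.trans hn

theorem Lang.bounds {d : ℕ} (hd : 3 ≤ d) {u : List ℕ} (h : Lang d u) :
    ∀ a ∈ u, 1 ≤ a ∧ a ≤ d := fun a ha => by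
  obtain ⟨n, hn⟩ := h
  exact mem_sigIter_bounds hd n a (hn.subset ha)

theorem Lang.zero_notMem {d : ℕ} (hd : 3 ≤ d) {u : List ℕ} (h : Lang d u) : 0 ∉ u :=
  fun h0 => by have := h.bounds hd 0 h0; omega

theorem Lang.adjPair {d : ℕ} (hd : 3 ≤ d) {a b : ℕ} (x y : List ℕ)
    (h : Lang d (x ++ a :: b :: y)) : AdjPair d a b := by
  obtain ⟨n, hn⟩ := h
  have : [a, b] <:+: sigIter d n [1] := List.IsInfix.trans ⟨x, y, by simp⟩ hn
  exact List.isChain_pair.1 ((isChain_sigIter hd n).infix this)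

theorem lang_nil (d : ℕ) : Lang d [] := ⟨0, List.nil_infix⟩

theorem prefix_of_applySub_prefix {d b : ℕ} (hb : b ≠ 2) {v w : List ℕ} (hv : 0 ∉ v)
    (hw : 0 ∉ w) (h : applySub (sig d) v ++ [b] <+: applySub (sig d) w) : v <+: w := by
  induction v generalizing w with
  | nil => exact List.nil_prefix
  | cons a v ih =>
    cases w with
    | nil =>
      have := sig_ne_nil d a
      simp [applySub] at h
    | cons c w =>
      simp only [List.mem_cons, not_or] at hv hw
      have key : ∀ e, 0 ∉ (e :: w) → ∀ l, ¬ (2 :: l <+: applySub (sig d) w) := by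
        intro e he l hl
        cases w with
        | nil => simp [applySub] at hl
        | cons e w =>
          simp only [applySub, sig] at hl
          simp only [List.mem_cons, not_or] at hw
          split_ifs at hl <;> simp at hl <;> omega
      have key2 : ∀ l, ¬ (applySub (sig d) v ++ [b] <+: 2 :: l) := by
        intro l hl
        cases v with
        | nil => simp [applySub] at hl; exact hb hl
        | cons e v =>
          simp only [applySub, sig] at hl
          simp only [List.mem_cons, not_or] at hv
          split_ifs at hl <;> simp at hl <;> omega
      have hac : a = c ∧ applySub (sig d) v ++ [b] <+: applySub (sig d) w := by
        simp only [applySub, List.append_assoc] at h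
        simp only [sig] at h
        split_ifs at h with h1 h2 h3 h4 h5 h6 h7 h8 <;> simp at h
        all_goals first
          | exact ⟨by omega, h⟩
          | exact ⟨by omega, h.2⟩
          | exact absurd h (key2 _)
          | exact absurd h (key c (by simp; tauto) _)
          | omega
      obtain ⟨rfl, h'⟩ := hac
      exact List.cons_prefix_cons.2 ⟨rfl, ih hv.2 hw.2 h'⟩

theorem infix_of_applySub_infix {d b : ℕ} (hb : b ≠ 2) {v w : List ℕ} (hv : 0 ∉ v)
    (hw : 0 ∉ w) (h : applySub (sig d) v ++ [b] <:+: applySub (sig d) w) : v <:+: w := by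
  cases v with
  | nil => exact List.nil_infix
  | cons a v =>
  induction w with
  | nil => simp [applySub] at h
  | cons c w ih =>
    have hw' : 0 ∉ w := fun h => hw (by simp [h])
    have step : applySub (sig d) (a :: v) ++ [b] <+: applySub (sig d) (c :: w) ∨
        applySub (sig d) (a :: v) ++ [b] <:+: applySub (sig d) w := by
      by_cases hc : c = 1
      · have h2 : ¬ (applySub (sig d) (a :: v) ++ [b] <+: 2 :: applySub (sig d) w) := by
          intro hl
          simp only [applySub, sig] at hl
          simp only [List.mem_cons, not_or] at hv
          split_ifs at hl <;> simp at hl <;> omega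
        have e : applySub (sig d) (c :: w) = 1 :: 2 :: applySub (sig d) w := by
          simp [applySub, sig, hc]
        rw [e] at h ⊢
        rcases List.infix_cons_iff.1 h with h | h
        · exact Or.inl h
        · exact Or.inr ((List.infix_cons_iff.1 h).resolve_left h2)
      · obtain ⟨x, hx⟩ : ∃ x, sig d c = [x] := by
          unfold sig; split_ifs <;> exact ⟨_, rfl⟩
        have e : applySub (sig d) (c :: w) = x :: applySub (sig d) w := by
          simp [applySub, hx]
        rw [e] at h ⊢
        exact List.infix_cons_iff.1 h
    rcases step with h | h
    · exact (prefix_of_applySub_prefix hb hv hw h).isInfix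
    · exact (ih hw' h).trans (List.suffix_cons _ _).isInfix

theorem Lang.desubstitute {d b : ℕ} (hd : 3 ≤ d) (hb : b ≠ 2) {v : List ℕ} (hv : 0 ∉ v)
    (h : Lang d (applySub (sig d) v ++ [b])) : Lang d v := by
  obtain ⟨n, hn⟩ := h
  cases n with
  | zero =>
    cases v with
    | nil => exact lang_nil d
    | cons a v =>
      have h1 := hn.length_le
      have h2 := length_le_length_applySub_sig d (a :: v)
      simp [sigIter] at h1 h2
      simp [h1] at h2
  | succ n =>
    rw [sigIter_succ] at hn
    exact ⟨n, infix_of_applySub_infix hb hv (Lang.zero_notMem hd ⟨n, List.infix_rfl⟩) hn⟩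

/-- The prefix of length `m` of an infinite word. -/
def pref (ω : ℕ → ℕ) (m : ℕ) : List ℕ := (List.range m).map ω

/-- The factor of length `n` of an infinite word starting at position `i`. -/
def fac (ω : ℕ → ℕ) (i n : ℕ) : List ℕ := (List.range n).map fun j => ω (i + j)

@[simp] theorem length_pref (ω : ℕ → ℕ) (m : ℕ) : (pref ω m).length = m := by simp [pref]

@[simp] theorem length_fac (ω : ℕ → ℕ) (i n : ℕ) : (fac ω i n).length = n := by simp [fac]

theorem fac_zero_left (ω : ℕ → ℕ) (n : ℕ) : fac ω 0 n = pref ω n := by simp [fac, pref]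

theorem pref_succ (ω : ℕ → ℕ) (m : ℕ) : pref ω (m + 1) = pref ω m ++ [ω m] := by
  simp [pref, List.range_succ]

theorem fac_succ (ω : ℕ → ℕ) (i n : ℕ) : fac ω i (n + 1) = fac ω i n ++ [ω (i + n)] := by
  simp [fac, List.range_succ]

theorem fac_succ_cons (ω : ℕ → ℕ) (i n : ℕ) : fac ω i (n + 1) = ω i :: fac ω (i + 1) n := by
  simp [fac, List.range_succ_eq_map, add_assoc, add_comm 1, Function.comp_def]

theorem fac_add (ω : ℕ → ℕ) (i m n : ℕ) : fac ω i (m + n) = fac ω i m ++ fac ω (i + m) n := by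
  induction n with
  | zero => simp [fac]
  | succ n ih => rw [← add_assoc, fac_succ, ih, fac_succ, List.append_assoc, add_assoc]

theorem prefixOfInf_iff {ω : ℕ → ℕ} {w : List ℕ} : PrefixOfInf w ω ↔ w = pref ω w.length := by
  constructor
  · intro h
    refine List.ext_getElem (by simp) fun i h1 _ => ?_
    simpa [pref] using h i h1
  · intro h i hi
    have : w[i] = (pref ω w.length)[i]'(by simpa using hi) := by congr 1
    simpa [pref] using this

theorem prefixOfInf_shift_iff {ω : ℕ → ℕ} {w : List ℕ} (i : ℕ) :
    PrefixOfInf w (fun j => ω (i + j)) ↔ w = fac ω i w.length := prefixOfInf_iff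

theorem pref_prefix (ω : ℕ → ℕ) {m n : ℕ} (h : m ≤ n) : pref ω m <+: pref ω n := by
  obtain ⟨k, rfl⟩ := Nat.exists_eq_add_of_le h
  rw [← fac_zero_left, ← fac_zero_left, fac_add]
  exact List.prefix_append _ _

theorem prefix_pref_iff {ω : ℕ → ℕ} {w : List ℕ} {n : ℕ} (h : w <+: pref ω n) :
    w = pref ω w.length := by
  have hl := h.length_le
  rw [length_pref] at hl
  exact (List.prefix_of_prefix_length_le h (pref_prefix ω hl) (by simp)).eq_of_length (by simp)

section FixedPoint

variable {d : ℕ} {ω : ℕ → ℕ}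

theorem IsSigmaFixedPoint.sigIter_eq (hω : IsSigmaFixedPoint d ω) (n : ℕ) :
    sigIter d n [1] = pref ω (sigIter d n [1]).length := prefixOfInf_iff.1 (hω n)

theorem IsSigmaFixedPoint.applySub_pref (hω : IsSigmaFixedPoint d ω) (k : ℕ) :
    applySub (sig d) (pref ω k) = pref ω (applySub (sig d) (pref ω k)).length := by
  have h := hω.sigIter_eq k
  have hk : pref ω k <+: sigIter d k [1] :=
    h ▸ pref_prefix ω (lt_length_sigIter_one d k).le
  obtain ⟨t, ht⟩ := hk
  refine prefix_pref_iff (n := (sigIter d (k + 1) [1]).length) ?_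
  rw [← hω.sigIter_eq, sigIter_succ, ← ht, applySub_append]
  exact List.prefix_append _ _

theorem IsSigmaFixedPoint.zero (hω : IsSigmaFixedPoint d ω) : ω 0 = 1 := by
  have h := hω 0 0 (by simp [sigIter])
  simpa [sigIter] using h.symm

theorem IsSigmaFixedPoint.one (hω : IsSigmaFixedPoint d ω) : ω 1 = 2 := by
  have h := hω 1 1 (by simp [sigIter, applySub, sig])
  simpa [sigIter, applySub, sig] using h.symm

theorem IsSigmaFixedPoint.lang_pref (hω : IsSigmaFixedPoint d ω) (m : ℕ) :
    Lang d (pref ω m) := by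
  refine ⟨m, ?_⟩
  rw [hω.sigIter_eq]
  exact (pref_prefix ω (lt_length_sigIter_one d m).le).isInfix

theorem IsSigmaFixedPoint.lang_fac (hω : IsSigmaFixedPoint d ω) (i n : ℕ) :
    Lang d (fac ω i n) := by
  refine (hω.lang_pref (i + n)).of_infix ?_
  rw [← fac_zero_left, fac_add, zero_add]
  exact (List.suffix_append _ _).isInfix

theorem IsSigmaFixedPoint.lang_iff (hω : IsSigmaFixedPoint d ω) (u : List ℕ) :
    Lang d u ↔ ∃ i, u = fac ω i u.length := by
  constructor
  · rintro ⟨n, s, t, h⟩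
    refine ⟨s.length, ?_⟩
    have h' := hω.sigIter_eq n
    rw [← h, ← fac_zero_left, List.length_append, List.length_append, fac_add, fac_add,
      zero_add] at h'
    have h1 := List.append_inj_left h' (by simp)
    exact List.append_inj_right h1 (by simp)
  · rintro ⟨i, hi⟩
    rw [hi]
    exact hω.lang_fac i _

theorem IsSigmaFixedPoint.adjPair (hd : 3 ≤ d) (hω : IsSigmaFixedPoint d ω) (i : ℕ) :
    AdjPair d (ω i) (ω (i + 1)) := by
  have h := hω.lang_fac i 2
  rw [fac_succ_cons, fac_succ_cons] at h
  exact Lang.adjPair hd [] _ h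

theorem IsSigmaFixedPoint.bounds (hd : 3 ≤ d) (hω : IsSigmaFixedPoint d ω) (i : ℕ) :
    1 ≤ ω i ∧ ω i ≤ d :=
  ⟨(hω.adjPair hd i).1, (hω.adjPair hd i).2.1⟩

theorem IsSigmaFixedPoint.exists_append (hω : IsSigmaFixedPoint d ω) {u : List ℕ}
    (h : Lang d u) : ∃ b, Lang d (u ++ [b]) := by
  obtain ⟨i, hi⟩ := (hω.lang_iff u).1 h
  refine ⟨ω (i + u.length), ?_⟩
  rw [hi, length_fac, ← fac_succ]
  exact hω.lang_fac _ _

theorem IsSigmaFixedPoint.lang_one_two (hd : 3 ≤ d) (hω : IsSigmaFixedPoint d ω) {u : List ℕ}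
    (h : Lang d (2 :: u)) : Lang d (1 :: 2 :: u) := by
  obtain ⟨i, hi⟩ := (hω.lang_iff _).1 h
  have h2 : ω i = 2 := by
    rw [List.length_cons, fac_succ_cons] at hi
    exact (List.cons.inj hi).1.symm
  cases i with
  | zero => rw [hω.zero] at h2; omega
  | succ i =>
    have h1 : ω i = 1 := by
      have := hω.adjPair hd i
      unfold AdjPair at this
      omega
    have := hω.lang_fac i ((2 :: u).length + 1)
    rwa [fac_succ_cons, ← hi, h1] at this

theorem IsSigmaFixedPoint.eq_of_lang_one_one (hd : 3 ≤ d) (hω : IsSigmaFixedPoint d ω)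
    {x : List ℕ} {e : ℕ} (h : Lang d (x ++ [e, 1, 1])) : e = d := by
  replace h : Lang d [e, 1, 1] := h.of_infix (List.suffix_append _ _).isInfix
  have hb := h.bounds hd e (by simp)
  have key : ∀ a, a ≠ 0 → Lang d (applySub (sig d) [a, d] ++ [1]) → AdjPair d a d := by
    intro a ha h
    exact Lang.adjPair hd [] [] (h.desubstitute hd (by simp) (by simp; omega))
  by_cases h1 : e = 1
  · have := key d (by omega) (by simpa [applySub, sig, show d ≠ 1 by omega, h1] using h)
    unfold AdjPair at this; omega
  by_cases h2 : e = 2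
  · subst h2
    have := key 1 (by omega)
      (by simpa [applySub, sig, show d ≠ 1 by omega] using hω.lang_one_two hd h)
    unfold AdjPair at this; omega
  · have := key (e - 1) (by omega)
      (by simpa [applySub, sig, show d ≠ 1 by omega, show e - 1 ≠ 1 by omega,
        show e - 1 ≠ d by omega, show e - 1 + 1 = e by omega] using h)
    unfold AdjPair at this; omega

/-- The letter `a` such that `σ(a)` ends with a given letter. -/
def predLetter (d a : ℕ) : ℕ := if a = 1 then d else a - 1

theorem predLetter_injOn {a b : ℕ} (ha : 1 ≤ a ∧ a ≤ d) (hb : 1 ≤ b ∧ b ≤ d)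
    (h : predLetter d a = predLetter d b) : a = b := by
  unfold predLetter at h
  split_ifs at h <;> omega

theorem IsSigmaFixedPoint.desubstitute_cons (hd : 3 ≤ d) (hω : IsSigmaFixedPoint d ω)
    {a x : ℕ} (hx : x ≠ 2) {v : List ℕ} (hv : 0 ∉ v)
    (h : Lang d (a :: (applySub (sig d) v ++ [x]))) : Lang d (predLetter d a :: v) := by
  have hb := h.bounds hd a (by simp)
  have key : Lang d (applySub (sig d) (predLetter d a :: v) ++ [x]) := by
    unfold predLetter
    split_ifs with h1
    · simpa [applySub, sig, show d ≠ 1 by omega, h1] using h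
    by_cases h2 : a = 2
    · subst h2
      simpa [applySub, sig] using hω.lang_one_two hd h
    · simpa [applySub, sig, show d ≠ 1 by omega, show a - 1 ≠ 1 by omega,
        show a - 1 ≠ d by omega, show a - 1 + 1 = a by omega] using h
  refine key.desubstitute hd hx ?_
  simp only [List.mem_cons, not_or]
  refine ⟨?_, hv⟩
  unfold predLetter; split_ifs <;> omega

/-- The last letter of `σ(c)`. -/
def succLetter (d c : ℕ) : ℕ := if c = d then 1 else c + 1

theorem sig_of_ne_one {d c : ℕ} (hc : c ≠ 1) : sig d c = [succLetter d c] := by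
  unfold sig succLetter
  rw [if_neg hc]
  split_ifs <;> rfl

theorem applySub_append_singleton (hd : 3 ≤ d) (v : List ℕ) (c : ℕ) :
    ∃ y, applySub (sig d) (v ++ [c]) = y ++ [succLetter d c] := by
  rw [applySub_append, applySub_singleton]
  by_cases hc : c = 1
  · refine ⟨applySub (sig d) v ++ [1], ?_⟩
    rw [hc, succLetter, if_neg (by omega)]
    simp [sig]
  · exact ⟨_, by rw [sig_of_ne_one hc]⟩

theorem IsSigmaFixedPoint.pref_zero_notMem (hd : 3 ≤ d) (hω : IsSigmaFixedPoint d ω) (k : ℕ) :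
    0 ∉ pref ω k := (hω.lang_pref k).zero_notMem hd

theorem IsSigmaFixedPoint.block_of_eq_one (hω : IsSigmaFixedPoint d ω) {m k : ℕ}
    (h : pref ω m = applySub (sig d) (pref ω k)) (hk : ω k = 1) :
    ω m = 1 ∧ ω (m + 1) = 2 := by
  have h' := hω.applySub_pref (k + 1)
  rw [pref_succ, applySub_append, applySub_singleton, ← h, hk] at h'
  simp only [sig, if_true, List.length_append, length_pref, List.length_cons, List.length_nil,
    zero_add] at h'
  rw [show m + (1 + 1) = m + 1 + 1 from rfl, pref_succ, pref_succ] at h'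
  simp at h'
  omega

theorem IsSigmaFixedPoint.block_of_ne_one (hω : IsSigmaFixedPoint d ω) {m k : ℕ}
    (h : pref ω m = applySub (sig d) (pref ω k)) (hk : ω k ≠ 1) :
    ω m = succLetter d (ω k) := by
  have h' := hω.applySub_pref (k + 1)
  rw [pref_succ, applySub_append, applySub_singleton, ← h, sig_of_ne_one hk] at h'
  simp only [List.length_append, length_pref, List.length_cons, List.length_nil,
    zero_add] at h'
  rw [pref_succ] at h'
  simpa using h'.symm

theorem IsSigmaFixedPoint.exists_block (hω : IsSigmaFixedPoint d ω) (m : ℕ) :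
    ∃ k, pref ω m = applySub (sig d) (pref ω k) ∨
      (ω k = 1 ∧ ω m = 2 ∧ pref ω m = applySub (sig d) (pref ω k) ++ [1]) := by
  induction m with
  | zero => exact ⟨0, Or.inl rfl⟩
  | succ m ih =>
    obtain ⟨k, h | ⟨h1, h2, h⟩⟩ := ih
    · by_cases hk : ω k = 1
      · obtain ⟨h3, h4⟩ := hω.block_of_eq_one h hk
        exact ⟨k, Or.inr ⟨hk, h4, by rw [pref_succ, h, h3]⟩⟩
      · refine ⟨k + 1, Or.inl ?_⟩
        rw [pref_succ, pref_succ, applySub_append, applySub_singleton, h,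
          hω.block_of_ne_one h hk, sig_of_ne_one hk]
    · refine ⟨k + 1, Or.inl ?_⟩
      rw [pref_succ, pref_succ, applySub_append, applySub_singleton, h, h1, h2]
      simp [sig]

/-- Every prefix of length at least two is, up to a trailing `1`, the image of a shorter
nonempty prefix. -/
theorem IsSigmaFixedPoint.exists_block_succ (hω : IsSigmaFixedPoint d ω) {m : ℕ} (hm : 2 ≤ m) :
    ∃ k, k + 1 < m ∧ pref ω m = applySub (sig d) (pref ω (k + 1)) ∨
      k + 2 < m ∧ ω (k + 1) = 1 ∧ ω m = 2 ∧
        pref ω m = applySub (sig d) (pref ω (k + 1)) ++ [1] := by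
  obtain ⟨k, hk⟩ := hω.exists_block m
  have hlen := hk.imp (congrArg List.length) (fun h => congrArg List.length h.2.2)
  simp only [List.length_append, length_pref, List.length_singleton] at hlen
  cases k with
  | zero => simp [pref, applySub] at hlen; omega
  | succ k =>
    have h2 : k + 2 ≤ (applySub (sig d) (pref ω (k + 1))).length := by
      have := length_le_length_applySub_sig d (fac ω 1 k)
      rw [← fac_zero_left, fac_succ_cons, hω.zero, zero_add]
      simp only [applySub, sig, if_true, List.length_append, List.length_cons, List.length_nil]
      simp only [length_fac] at this
      omega
    refine ⟨k, ?_⟩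
    rcases hk with h | ⟨h1, h3, h⟩
    · refine Or.inl ⟨?_, h⟩
      have := congrArg List.length h
      rw [length_pref] at this
      omega
    · refine Or.inr ⟨?_, h1, h3, h⟩
      have := congrArg List.length h
      simp only [List.length_append, length_pref, List.length_singleton] at this
      omega

end FixedPoint

theorem IsSigmaFixedPoint.eq_of_leftSpecial_append {d : ℕ} {ω : ℕ → ℕ} (hd : 3 ≤ d)
    (hω : IsSigmaFixedPoint d ω) (m : ℕ) : ∀ e a b : ℕ, a ≠ b →
      Lang d (a :: (pref ω m ++ [e])) → Lang d (b :: (pref ω m ++ [e])) → e = ω m := by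
  induction m using Nat.strong_induction_on with
  | _ m ih =>
  intro e a b hab ha hb
  have hpair : ∀ {a c e v}, Lang d (a :: (v ++ [c] ++ [e])) → AdjPair d c e := by
    intro a c e v h
    exact Lang.adjPair hd (a :: v) [] (by simpa using h)
  have hdesub : ∀ {k x y z : ℕ}, k < m → x ≠ 0 → y ≠ 2 → z ≠ 2 →
      Lang d (a :: (applySub (sig d) (pref ω k ++ [x]) ++ [y])) →
      Lang d (b :: (applySub (sig d) (pref ω k ++ [x]) ++ [z])) → x = ω k := by
    intro k x y z hk hx hy hz h1 h2
    have h0 : 0 ∉ pref ω k ++ [x] := by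
      simp only [List.mem_append, List.mem_singleton, not_or]
      exact ⟨hω.pref_zero_notMem hd k, hx.symm⟩
    refine ih k hk x _ _ ?_ (hω.desubstitute_cons hd hy h0 h1) (hω.desubstitute_cons hd hz h0 h2)
    exact fun h => hab (predLetter_injOn (ha.bounds hd a (by simp)) (hb.bounds hd b (by simp)) h)
  have hnext : ∀ {a v x}, x ≠ 1 → Lang d (a :: (v ++ [x])) →
      ∃ y, y ≠ 2 ∧ Lang d (a :: (v ++ [x] ++ [y])) := by
    intro a v x hx h
    obtain ⟨y, hy⟩ := hω.exists_append h
    refine ⟨y, ?_, by simpa using hy⟩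
    have := hpair (v := v) (by simpa using hy)
    unfold AdjPair at this
    omega
  have h12 : ∀ {a v c}, c ≠ d - 1 → Lang d (a :: (applySub (sig d) (v ++ [c]) ++ [1])) →
      Lang d (a :: (applySub (sig d) (v ++ [c]) ++ [1] ++ [2])) := by
    intro a v c hc h
    obtain ⟨y, hy⟩ := applySub_append_singleton hd v c
    obtain ⟨x, hx⟩ := hω.exists_append h
    have h1 : AdjPair d 1 x := hpair (by simpa using hx)
    have h2 : x ≠ 1 := by
      rintro rfl
      have := hω.eq_of_lang_one_one hd (x := a :: y) (e := succLetter d c) (by simpa [hy] using hx)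
      unfold succLetter at this
      split_ifs at this <;> omega
    have : x = 2 := by unfold AdjPair at h1; omega
    subst this
    simpa using hx
  rcases Nat.lt_or_ge m 2 with hm | hm
  · interval_cases m
    · have := Lang.adjPair hd [] [] ha
      have := Lang.adjPair hd [] [] hb
      rw [hω.zero]
      unfold AdjPair at *
      omega
    · have h1 : pref ω 1 = [1] := by rw [pref_succ, hω.zero]; rfl
      rw [h1] at ha hb
      rw [hω.one]
      have h3 := hpair (v := []) ha
      unfold AdjPair at h3
      have : e ≠ 1 := by
        rintro rfl
        have := hω.eq_of_lang_one_one hd (x := []) ha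
        have := hω.eq_of_lang_one_one hd (x := []) hb
        omega
      omega
  obtain ⟨k, ⟨hk, h⟩ | ⟨hk, h1, h2, h⟩⟩ := hω.exists_block_succ hm
  · obtain ⟨y, hy⟩ := applySub_append_singleton hd (pref ω k) (ω k)
    have hadj := hω.adjPair hd k
    have hpm : pref ω m = y ++ [succLetter d (ω k)] := by rw [h, pref_succ, hy]
    have hpe := hpair (hpm ▸ ha)
    have hσ1 : ∀ v, applySub (sig d) (v ++ [1]) = applySub (sig d) v ++ [1] ++ [2] := by
      intro v
      simp [applySub_append, applySub, sig]
    by_cases hcd : ω k = d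
    · obtain ⟨k, rfl⟩ : ∃ j, k = j + 1 :=
        Nat.exists_eq_succ_of_ne_zero (by rintro rfl; rw [hω.zero] at hcd; omega)
      have h1 : ω (k + 1 + 1) = 1 := by unfold AdjPair at hadj; omega
      rw [(hω.block_of_eq_one h h1).1]
      rw [succLetter, if_pos hcd] at hpe
      by_contra he
      have he2 : e = 2 := by unfold AdjPair at hpe; omega
      have hm' : pref ω m = applySub (sig d) (pref ω (k + 1)) ++ [1] := by
        rw [h, pref_succ, hcd, applySub_append, applySub_singleton, sig_of_ne_one (by omega),
          succLetter, if_pos rfl]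
      rw [hm', he2] at ha hb
      obtain ⟨y, hy, ha⟩ := hnext (by simp) ha
      obtain ⟨z, hz, hb⟩ := hnext (by simp) hb
      rw [← hσ1] at ha hb
      have := hdesub (by omega) (by simp) hy hz ha hb
      omega
    · rw [succLetter, if_neg hcd] at hpe
      by_cases hcd1 : ω k = d - 1
      · have he : e = 1 := by unfold AdjPair at hpe; omega
        by_cases h1 : ω (k + 1) = 1
        · rw [he, (hω.block_of_eq_one h h1).1]
        · rw [he, hω.block_of_ne_one h h1, succLetter, if_pos]
          unfold AdjPair at hadj; omega
      by_cases he : e = 1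
      · subst he
        rw [h, pref_succ] at ha hb
        replace ha := h12 hcd1 ha
        replace hb := h12 hcd1 hb
        obtain ⟨y, hy, ha⟩ := hnext (by simp) ha
        obtain ⟨z, hz, hb⟩ := hnext (by simp) hb
        rw [← pref_succ, ← hσ1] at ha hb
        have := hdesub (by omega) (by simp) hy hz ha hb
        exact (hω.block_of_eq_one h this.symm).1.symm
      · have hs : [e] = sig d (ω k + 1) := by
          unfold AdjPair at hpe hadj
          rw [sig_of_ne_one (by omega), succLetter, if_neg (by omega)]
          congr 1
          omega
        obtain ⟨y, hy, ha⟩ := hnext he ha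
        obtain ⟨z, hz, hb⟩ := hnext he hb
        rw [h, hs, ← applySub_singleton (sig d), ← applySub_append] at ha hb
        have := hdesub (by omega) (by simp) hy hz ha hb
        rw [hω.block_of_ne_one h (by unfold AdjPair at hadj; omega), ← this]
        rw [sig_of_ne_one (by unfold AdjPair at hadj; omega)] at hs
        simpa using hs
  · rw [h2]
    rw [h] at ha hb
    have hpe := hpair ha
    by_contra he
    have he1 : e = 1 := by unfold AdjPair at hpe; omega
    subst he1
    obtain ⟨y, hy⟩ := applySub_append_singleton hd (pref ω k) (ω k)
    have := hω.eq_of_lang_one_one hd (x := a :: y) (e := succLetter d (ω k))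
      (by simpa [pref_succ, hy] using ha)
    have hs : [1] = sig d d := by
      rw [sig_of_ne_one (by omega), succLetter, if_pos rfl]
    have hσd : applySub (sig d) (pref ω (k + 1)) ++ [1] =
        applySub (sig d) (pref ω (k + 1) ++ [d]) := by
      rw [applySub_append, applySub_singleton, hs]
    rw [hσd] at ha hb
    have := hdesub (show k + 1 < m by omega) (by omega) (by simp) (by simp) ha hb
    omega

theorem IsSigmaFixedPoint.eq_pref_of_leftSpecial {d : ℕ} {ω : ℕ → ℕ} (hd : 3 ≤ d)
    (hω : IsSigmaFixedPoint d ω) {a b : ℕ} (hab : a ≠ b) (u : List ℕ) :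
    Lang d (a :: u) → Lang d (b :: u) → u = pref ω u.length := by
  induction u using List.reverseRecOn with
  | nil => intro _ _; rfl
  | append_singleton u e ih =>
    intro ha hb
    have h := ih (ha.of_infix ⟨[], [e], by simp⟩) (hb.of_infix ⟨[], [e], by simp⟩)
    rw [h] at ha hb
    have he := hω.eq_of_leftSpecial_append hd _ e a b hab ha hb
    rw [List.length_append, List.length_singleton, pref_succ, ← he, ← h]

/-! ### Consistent families of weights on the language -/

/-- A nonnegative weight on words supported on the language and satisfying the Kolmogorov
consistency relations on both sides, as the cylinder measures of an invariant measure do. -/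
structure ConsistentWeight (d : ℕ) (f : List ℕ → ℝ) : Prop where
  nonneg : ∀ u, 0 ≤ f u
  lang : ∀ u, f u ≠ 0 → Lang d u
  right : ∀ u, f u = ∑ a ∈ Finset.Icc 1 d, f (u ++ [a])
  left : ∀ u, f u = ∑ a ∈ Finset.Icc 1 d, f (a :: u)

namespace ConsistentWeight

variable {d : ℕ} {f : List ℕ → ℝ}

theorem eq_zero (hf : ConsistentWeight d f) {u : List ℕ} (h : ¬ Lang d u) : f u = 0 := by
  by_contra h0
  exact h (hf.lang u h0)

theorem eq_append (hf : ConsistentWeight d f) {u : List ℕ} {b : ℕ} (hb : 1 ≤ b ∧ b ≤ d)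
    (h : ∀ a, a ≠ b → ¬ Lang d (u ++ [a])) : f u = f (u ++ [b]) := by
  rw [hf.right u]
  refine Finset.sum_eq_single b (fun a _ hab => hf.eq_zero (h a hab)) fun h => ?_
  simp at h; omega

theorem eq_cons (hf : ConsistentWeight d f) {u : List ℕ} {b : ℕ} (hb : 1 ≤ b ∧ b ≤ d)
    (h : ∀ a, a ≠ b → ¬ Lang d (a :: u)) : f u = f (b :: u) := by
  rw [hf.left u]
  refine Finset.sum_eq_single b (fun a _ hab => hf.eq_zero (h a hab)) fun h => ?_
  simp at h; omega

theorem cons_le (hf : ConsistentWeight d f) {b : ℕ} (hb : 1 ≤ b ∧ b ≤ d) (u : List ℕ) :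
    f (b :: u) ≤ f u := by
  rw [hf.left u]
  exact Finset.single_le_sum (f := fun a => f (a :: u)) (fun a _ => hf.nonneg _)
    (Finset.mem_Icc.2 hb)

theorem append_le (hf : ConsistentWeight d f) {b : ℕ} (hb : 1 ≤ b ∧ b ≤ d) (u : List ℕ) :
    f (u ++ [b]) ≤ f u := by
  rw [hf.right u]
  exact Finset.single_le_sum (f := fun a => f (u ++ [a])) (fun a _ => hf.nonneg _)
    (Finset.mem_Icc.2 hb)

theorem two_cons (hd : 3 ≤ d) (hf : ConsistentWeight d f) (u : List ℕ) :
    f (2 :: u) = f (1 :: 2 :: u) := by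
  refine hf.eq_cons (by omega) fun a ha h => ?_
  have := Lang.adjPair hd [] _ h
  unfold AdjPair at this
  omega

theorem append_two_eq_zero (hd : 3 ≤ d) (hf : ConsistentWeight d f) (x : List ℕ) {a : ℕ}
    (ha : a ≠ 1) : f (x ++ [a, 2]) = 0 := by
  refine hf.eq_zero fun h => ?_
  have := Lang.adjPair hd x [] h
  unfold AdjPair at this
  omega

theorem append_last (hd : 3 ≤ d) (hf : ConsistentWeight d f) (x : List ℕ) :
    f (x ++ [d]) = f (x ++ [d, 1]) := by
  rw [hf.eq_append (b := 1) (by omega) fun a ha h => ?_]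
  · simp
  · have := Lang.adjPair hd x [] (by simpa using h)
    unfold AdjPair at this
    omega

theorem append_one (hd : 3 ≤ d) (hf : ConsistentWeight d f) (x : List ℕ) :
    f (x ++ [1]) = f (x ++ [1, 1]) + f (x ++ [1, 2]) := by
  rw [hf.right, ← Finset.sum_subset (s₁ := {1, 2})]
  · rw [Finset.sum_pair (by simp)]
    simp
  · intro a ha
    simp at ha ⊢
    omega
  · intro a _ ha
    refine hf.eq_zero fun h => ha ?_
    have := Lang.adjPair hd x [] (by simpa using h)
    unfold AdjPair at this
    simp
    omega

theorem append_one_of_ne {ω : ℕ → ℕ} (hd : 3 ≤ d) (hω : IsSigmaFixedPoint d ω)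
    (hf : ConsistentWeight d f) (x : List ℕ) {e : ℕ} (he : e ≠ d) :
    f (x ++ [e, 1]) = f (x ++ [e, 1, 2]) := by
  have h := hf.append_one hd (x ++ [e])
  have h0 : f (x ++ [e, 1, 1]) = 0 :=
    hf.eq_zero fun h => he (hω.eq_of_lang_one_one hd h)
  simpa [h0] using h

end ConsistentWeight

/-- The weight of `v` read off from occurrences of `σ(v)` followed by the image of a letter. -/
noncomputable def derivedWeight (d : ℕ) (f : List ℕ → ℝ) (v : List ℕ) : ℝ :=
  if 0 ∈ v then 0 else f (applySub (sig d) v) - f (applySub (sig d) v ++ [2])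

theorem sum_Icc_split {d : ℕ} (hd : 3 ≤ d) (g : ℕ → ℝ) :
    ∑ a ∈ Finset.Icc 1 d, g a = g 1 + ∑ a ∈ Finset.Ico 2 d, g a + g d := by
  have h : Finset.Icc 1 d = insert 1 (insert d (Finset.Ico 2 d)) := by
    ext a; simp; omega
  rw [h, Finset.sum_insert (by simp; omega), Finset.sum_insert (by simp)]
  ring

theorem sum_Icc_split' {d : ℕ} (hd : 3 ≤ d) (g : ℕ → ℝ) :
    ∑ a ∈ Finset.Icc 1 d, g a = g 1 + g 2 + ∑ a ∈ Finset.Ico 2 d, g (a + 1) := by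
  have h : Finset.Icc 1 d = insert 1 (insert 2 (Finset.Ico (2 + 1) (d + 1))) := by
    ext a; simp; omega
  rw [h, Finset.sum_insert (by simp), Finset.sum_insert (by simp), Finset.sum_Ico_add']
  ring

namespace ConsistentWeight

variable {d : ℕ} {f : List ℕ → ℝ}

theorem sum_sig_append (hd : 3 ≤ d) (hf : ConsistentWeight d f) (u : List ℕ) :
    ∑ a ∈ Finset.Icc 1 d, f (sig d a ++ u) = f u := by
  rw [sum_Icc_split hd, hf.left u, sum_Icc_split' hd, two_cons hd hf u]
  have h1 : sig d 1 = [1, 2] := by simp [sig]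
  have h2 : sig d d = [1] := by rw [sig_of_ne_one (by omega), succLetter, if_pos rfl]
  have h3 : ∑ a ∈ Finset.Ico 2 d, f (sig d a ++ u) =
      ∑ a ∈ Finset.Ico 2 d, f ((a + 1) :: u) := by
    refine Finset.sum_congr rfl fun a ha => ?_
    rw [Finset.mem_Ico] at ha
    rw [sig_of_ne_one (by omega), succLetter, if_neg (by omega)]
    rfl
  rw [h1, h2, h3]
  simp only [List.cons_append, List.nil_append]
  ring

theorem derivedWeight_eq (hd : 3 ≤ d) (hf : ConsistentWeight d f) {v : List ℕ} (hv : 0 ∉ v) :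
    derivedWeight d f v = f (applySub (sig d) v ++ [1]) +
      ∑ a ∈ Finset.Ico 2 d, f (applySub (sig d) v ++ [a + 1]) := by
  rw [derivedWeight, if_neg hv, hf.right, sum_Icc_split' hd]
  ring

theorem derived (hd : 3 ≤ d) (hf : ConsistentWeight d f) :
    ConsistentWeight d (derivedWeight d f) where
  nonneg v := by
    by_cases hv : 0 ∈ v
    · simp [derivedWeight, hv]
    · rw [derivedWeight_eq hd hf hv]
      exact add_nonneg (hf.nonneg _) (Finset.sum_nonneg fun a _ => hf.nonneg _)
  lang v h := by
    have hv : 0 ∉ v := by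
      intro hv
      simp [derivedWeight, hv] at h
    by_contra hl
    refine h ?_
    have key : ∀ b, b ≠ 2 → f (applySub (sig d) v ++ [b]) = 0 := fun b hb =>
      hf.eq_zero fun h => hl (h.desubstitute hd hb hv)
    rw [derivedWeight_eq hd hf hv, key 1 (by simp), zero_add]
    refine Finset.sum_eq_zero fun a ha => key _ ?_
    rw [Finset.mem_Ico] at ha
    omega
  right v := by
    by_cases hv : 0 ∈ v
    · simp [derivedWeight, hv]
    have h0 : ∀ a ∈ Finset.Icc 1 d, derivedWeight d f (v ++ [a]) =
        f (applySub (sig d) v ++ sig d a) - f (applySub (sig d) v ++ sig d a ++ [2]) := by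
      intro a ha
      rw [Finset.mem_Icc] at ha
      rw [derivedWeight, if_neg (by simp [hv]; omega), applySub_append, applySub_singleton]
    rw [Finset.sum_congr rfl h0, derivedWeight_eq hd hf hv, sum_Icc_split hd]
    have h1 : sig d 1 = [1, 2] := by simp [sig]
    have h2 : sig d d = [1] := by rw [sig_of_ne_one (by omega), succLetter, if_pos rfl]
    have h3 : ∑ a ∈ Finset.Ico 2 d, (f (applySub (sig d) v ++ sig d a) -
        f (applySub (sig d) v ++ sig d a ++ [2])) =
        ∑ a ∈ Finset.Ico 2 d, f (applySub (sig d) v ++ [a + 1]) := by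
      refine Finset.sum_congr rfl fun a ha => ?_
      rw [Finset.mem_Ico] at ha
      rw [sig_of_ne_one (by omega), succLetter, if_neg (by omega), List.append_assoc,
        List.singleton_append, hf.append_two_eq_zero hd _ (by omega), sub_zero]
    have h4 := hf.append_two_eq_zero hd (applySub (sig d) v ++ [1]) (a := 2) (by simp)
    simp only [List.append_assoc, List.cons_append, List.nil_append] at h4
    rw [h1, h2, h3]
    simp only [List.append_assoc, List.cons_append, List.nil_append]
    rw [h4]
    ring
  left v := by
    by_cases hv : 0 ∈ v
    · simp [derivedWeight, hv]
    have h0 : ∀ a ∈ Finset.Icc 1 d, derivedWeight d f (a :: v) =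
        f (sig d a ++ applySub (sig d) v) - f (sig d a ++ (applySub (sig d) v ++ [2])) := by
      intro a ha
      rw [Finset.mem_Icc] at ha
      rw [derivedWeight, if_neg (by simp [hv]; omega), applySub, List.append_assoc]
    rw [Finset.sum_congr rfl h0, Finset.sum_sub_distrib, sum_sig_append hd hf,
      sum_sig_append hd hf, derivedWeight, if_neg hv]

end ConsistentWeight

/-! ### The renewal equation -/

theorem renewal_invariant {d : ℕ} (hd : 1 ≤ d) {r : ℝ} (hr : r + r ^ d = 1)
    {t : ℕ → ℝ} (ht : ∀ n, t n = r * t (n + 1) + r ^ d * t (n + d)) (n : ℕ) :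
    t n + r ^ d * ∑ i ∈ Finset.range (d - 1), t (n + (i + 1)) =
      t 0 + r ^ d * ∑ i ∈ Finset.range (d - 1), t (i + 1) := by
  induction n with
  | zero => simp
  | succ n ih =>
    rw [← ih]
    have h1 := Finset.sum_range_succ (fun i => t (n + (i + 1))) (d - 1)
    have h2 := Finset.sum_range_succ' (fun i => t (n + (i + 1))) (d - 1)
    rw [show d - 1 + 1 = d by omega] at h1 h2
    have h3 : ∀ i, t (n + 1 + (i + 1)) = t (n + (i + 1 + 1)) := fun i => by congr 1; ring
    simp only [h3]
    rw [h1] at h2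
    have h4 := ht n
    have h5 : t (n + 1) = (r + r ^ d) * t (n + 1) := by rw [hr, one_mul]
    simp only [zero_add] at h2
    linear_combination h5 - h4 - r ^ d * h2

theorem renewal_partial_le {d : ℕ} (hd : 1 ≤ d) {r : ℝ} (h0 : 0 < r) (hr : r + r ^ d = 1)
    {t : ℕ → ℝ} (ht : ∀ n, t n = r * t (n + 1) + r ^ d * t (n + d))
    (hb : BddAbove (Set.range t)) (n : ℕ) :
    t n * (1 + r ^ d * (d - 1 : ℕ)) ≤ t 0 + r ^ d * ∑ i ∈ Finset.range (d - 1), t (i + 1) := by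
  have hC : 0 < r ^ d := pow_pos h0 d
  have hQ := renewal_invariant hd hr ht
  set S := ⨆ n, t n with hS
  have hle : ∀ n, t n ≤ S := fun n => le_ciSup hb n
  have hstep : ∀ n i, S - t (n + i) ≤ r⁻¹ ^ i * (S - t n) := by
    intro n i
    induction i with
    | zero => simp
    | succ i ih =>
      have h1 := ht (n + i)
      have h2 : r * (S - t (n + i + 1)) ≤ S - t (n + i) := by
        have := mul_le_mul_of_nonneg_left (hle (n + i + d)) hC.le
        have hrd : r ^ d = 1 - r := by linarith
        rw [hrd] at this h1
        linarith
      have h3 : S - t (n + (i + 1)) ≤ r⁻¹ * (S - t (n + i)) := by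
        rw [inv_mul_eq_div, le_div_iff₀ h0, mul_comm]
        exact h2
      calc _ ≤ _ := h3
        _ ≤ r⁻¹ * (r⁻¹ ^ i * (S - t n)) :=
          mul_le_mul_of_nonneg_left ih (inv_nonneg.2 h0.le)
        _ = _ := by ring
  set Q := t 0 + r ^ d * ∑ i ∈ Finset.range (d - 1), t (i + 1) with hQdef
  set K := 1 + r ^ d * ∑ i ∈ Finset.range (d - 1), r⁻¹ ^ (i + 1) with hK
  have hKpos : 0 < K := add_pos_of_pos_of_nonneg one_pos
    (mul_nonneg hC.le (Finset.sum_nonneg fun i _ => pow_nonneg (inv_nonneg.2 h0.le) _))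
  have hmain : ∀ n, S * (1 + r ^ d * (d - 1 : ℕ)) - Q ≤ K * (S - t n) := by
    intro n
    have h1 : ∑ i ∈ Finset.range (d - 1), (S - t (n + (i + 1))) ≤
        ∑ i ∈ Finset.range (d - 1), r⁻¹ ^ (i + 1) * (S - t n) :=
      Finset.sum_le_sum fun i _ => hstep n (i + 1)
    rw [Finset.sum_sub_distrib, Finset.sum_const, Finset.card_range, nsmul_eq_mul,
      ← Finset.sum_mul] at h1
    have h2 := mul_le_mul_of_nonneg_left h1 hC.le
    rw [← hQ n, hK]
    linarith
  have hfin : S * (1 + r ^ d * (d - 1 : ℕ)) ≤ Q := by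
    by_contra! hlt
    obtain ⟨n, hn⟩ := exists_lt_of_lt_ciSup
      (show S - (S * (1 + r ^ d * (d - 1 : ℕ)) - Q) / K < ⨆ n, t n from
        sub_lt_self _ (div_pos (by linarith) hKpos))
    have h2 : S - t n < (S * (1 + r ^ d * (d - 1 : ℕ)) - Q) / K := by linarith
    rw [lt_div_iff₀ hKpos] at h2
    linarith [hmain n]
  exact (mul_le_mul_of_nonneg_right (hle n) (by positivity)).trans hfin

theorem renewal_eq_geometric {d : ℕ} (hd : 1 ≤ d) {r : ℝ} (h0 : 0 < r) (hr : r + r ^ d = 1)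
    {s : ℕ → ℝ} (hs0 : ∀ n, 0 ≤ s n) (hs : ∀ n, s n = s (n + 1) + s (n + d)) (n : ℕ) :
    s n = s 0 * r ^ n := by
  have hr0 : r ≠ 0 := h0.ne'
  set t : ℕ → ℝ := fun n => s n / r ^ n with htdef
  have ht0 : ∀ n, 0 ≤ t n := fun n => div_nonneg (hs0 n) (pow_nonneg h0.le n)
  have ht : ∀ n, t n = r * t (n + 1) + r ^ d * t (n + d) := by
    intro n
    simp only [htdef]
    rw [hs n, add_div]
    congr 1
    · rw [pow_succ]; field_simp
    · rw [pow_add]; field_simp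
  have hb : BddAbove (Set.range t) := by
    refine ⟨t 0 + r ^ d * ∑ i ∈ Finset.range (d - 1), t (i + 1), ?_⟩
    rintro _ ⟨n, rfl⟩
    rw [← renewal_invariant hd hr ht n]
    exact le_add_of_nonneg_right
      (mul_nonneg (pow_nonneg h0.le d) (Finset.sum_nonneg fun i _ => ht0 _))
  have hb' : BddAbove (Set.range fun n => -t n) :=
    ⟨0, by rintro _ ⟨n, rfl⟩; simpa using ht0 n⟩
  have h1 := renewal_partial_le hd h0 hr ht hb
  have h2 := renewal_partial_le hd h0 hr (t := fun n => -t n)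
    (fun n => by linarith [ht n]) hb'
  simp only [Finset.sum_neg_distrib] at h2
  have hC : 0 < 1 + r ^ d * (d - 1 : ℕ) := by positivity
  have h3 : t n = t 0 := by
    refine mul_right_cancel₀ hC.ne' ?_
    linarith [h1 n, h2 n, h1 0, h2 0]
  have h4 : s n / r ^ n = s 0 := by simpa [htdef] using h3
  rw [← h4]
  field_simp

namespace ConsistentWeight

variable {d : ℕ} {f : List ℕ → ℝ}

theorem iterate (hd : 3 ≤ d) (hf : ConsistentWeight d f) (n : ℕ) :
    ConsistentWeight d ((derivedWeight d)^[n] f) := by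
  induction n with
  | zero => exact hf
  | succ n ih =>
    rw [Function.iterate_succ_apply']
    exact ih.derived hd

theorem letter_succ (hd : 3 ≤ d) (hf : ConsistentWeight d f) {k : ℕ} (hk : 1 ≤ k) (hkd : k < d) :
    f [k + 1] = derivedWeight d f [k] := by
  rw [derivedWeight, if_neg (by simp; omega), applySub_singleton]
  by_cases h1 : k = 1
  · subst h1
    have := hf.append_two_eq_zero hd [1] (a := 2) (by simp)
    simp only [List.cons_append, List.nil_append] at this
    simp [sig, this, hf.two_cons hd]
  · have := hf.append_two_eq_zero hd [] (a := k + 1) (by omega)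
    simp only [List.nil_append] at this
    rw [sig_of_ne_one h1, succLetter, if_neg (by omega)]
    simp [this]

theorem letter_one (hd : 3 ≤ d) (hf : ConsistentWeight d f) :
    f [1] = derivedWeight d f [1] + derivedWeight d f [d] := by
  rw [← hf.letter_succ hd le_rfl (by omega), derivedWeight, if_neg (by simp; omega),
    applySub_singleton, sig_of_ne_one (by omega), succLetter, if_pos rfl, hf.two_cons hd]
  simp

theorem letter_succ_iterate (hd : 3 ≤ d) (hf : ConsistentWeight d f) {j : ℕ} (hj : j < d) :
    f [j + 1] = (derivedWeight d)^[j] f [1] := by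
  induction j generalizing f with
  | zero => rfl
  | succ j ih =>
    rw [hf.letter_succ hd (by omega) hj, ih (hf.derived hd) (by omega),
      ← Function.iterate_succ_apply]

theorem iterate_letter_one (hd : 3 ≤ d) {r : ℝ} (h0 : 0 < r) (hr : r + r ^ d = 1)
    (hf : ConsistentWeight d f) (n : ℕ) :
    (derivedWeight d)^[n] f [1] = f [1] * r ^ n := by
  refine renewal_eq_geometric (s := fun n => (derivedWeight d)^[n] f [1]) (by omega) h0 hr
    (fun n => (hf.iterate hd n).nonneg _) (fun n => ?_) n
  rw [(hf.iterate hd n).letter_one hd, ← Function.iterate_succ_apply' (derivedWeight d) n f]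
  congr 1
  have h := ((hf.iterate hd (n + 1)).letter_succ_iterate hd (j := d - 1) (by omega))
  rw [show d - 1 + 1 = d by omega, ← Function.iterate_add_apply] at h
  rw [h, show d - 1 + (n + 1) = n + d by omega]

theorem letter_eq (hd : 3 ≤ d) {r : ℝ} (h0 : 0 < r) (hr : r + r ^ d = 1)
    (hf : ConsistentWeight d f) {j : ℕ} (hj : j < d) : f [j + 1] = f [] * r ^ (d - 1 + j) := by
  have hlet : ∀ j, j < d → f [j + 1] = f [1] * r ^ j := fun j hj => by
    rw [hf.letter_succ_iterate hd hj, hf.iterate_letter_one hd h0 hr]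
  have hsum : f [] = f [1] * ∑ j ∈ Finset.range d, r ^ j := by
    rw [hf.right, Finset.mul_sum,
      ← Finset.sum_congr rfl fun j hj => hlet j (Finset.mem_range.1 hj), Finset.range_eq_Ico,
      Finset.sum_Ico_add' (fun a => f [a]), zero_add]
    rfl
  have hgeom : (∑ j ∈ Finset.range d, r ^ j) * r ^ (d - 1) = 1 := by
    have h1 := geom_sum_mul_neg r d
    have h2 : r ^ d = r ^ (d - 1) * r := by rw [← pow_succ]; congr 1; omega
    rw [show 1 - r = r ^ d by linarith, show 1 - r ^ d = r by linarith, h2, ← mul_assoc] at h1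
    exact mul_right_cancel₀ h0.ne' (h1.trans (one_mul r).symm)
  rw [hlet j hj, hsum, pow_add]
  linear_combination (-(f [1] * r ^ j)) * hgeom

theorem derivedWeight_nil (hd : 3 ≤ d) {r : ℝ} (h0 : 0 < r) (hr : r + r ^ d = 1)
    (hf : ConsistentWeight d f) : derivedWeight d f [] = f [] * r := by
  have h1 := (hf.derived hd).letter_eq hd h0 hr (j := 0) (by omega)
  have h2 := hf.letter_eq hd h0 hr (j := 0) (by omega)
  have h3 := hf.iterate_letter_one hd h0 hr 1
  simp only [Function.iterate_one] at h3
  simp only [zero_add, add_zero] at h1 h2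
  rw [h1, h2] at h3
  refine mul_right_cancel₀ (pow_pos h0 (d - 1)).ne' ?_
  linarith

theorem succLetter_cons (hd : 3 ≤ d) (hf : ConsistentWeight d f) (a : ℕ) (u : List ℕ) :
    f (succLetter d a :: u) = f (sig d a ++ u) := by
  by_cases h : a = 1
  · subst h
    rw [succLetter, if_neg (by omega), hf.two_cons hd]
    simp [sig]
  · rw [sig_of_ne_one h]
    rfl

end ConsistentWeight

/-- The weight of the prefix of length `m`, in any left context, is the derived weight of the
prefix of length `q`. -/
def PrefixDerives (d : ℕ) (ω : ℕ → ℕ) (m q : ℕ) : Prop :=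
  ∀ f, ConsistentWeight d f → ∀ x, f (x ++ pref ω m) =
    f (x ++ applySub (sig d) (pref ω q)) - f (x ++ applySub (sig d) (pref ω q) ++ [2])

section PrefixDerives

variable {d : ℕ} {ω : ℕ → ℕ}

theorem prefixDerives_of_eq (hd : 3 ≤ d) (hω : IsSigmaFixedPoint d ω) {m k : ℕ}
    (hk : ω k ≠ d) (h : pref ω m = applySub (sig d) (pref ω (k + 1))) :
    PrefixDerives d ω m (k + 1) := by
  intro f hf x
  obtain ⟨y, hy⟩ := applySub_append_singleton hd (pref ω k) (ω k)
  have hb := hω.bounds hd k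
  have := hf.append_two_eq_zero hd (x ++ y) (a := succLetter d (ω k))
    (by rw [succLetter, if_neg hk]; omega)
  rw [h, pref_succ, hy]
  simp only [List.append_assoc, List.cons_append, List.nil_append] at this ⊢
  rw [this, sub_zero]

theorem prefixDerives_of_eq_append (hd : 3 ≤ d) {m k : ℕ}
    (hk : ω k = d - 1 ∨ ω k = d)
    (h : pref ω m = applySub (sig d) (pref ω (k + 1)) ++ [1]) :
    PrefixDerives d ω m (k + 1) := by
  intro f hf x
  obtain ⟨y, hy⟩ := applySub_append_singleton hd (pref ω k) (ω k)
  rw [h, pref_succ, hy]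
  rcases hk with hk | hk
  · have h1 := hf.append_last hd (x ++ y)
    have h2 := hf.append_two_eq_zero hd (x ++ y) (a := d) (by omega)
    have h3 : succLetter d (ω k) = d := by rw [succLetter, if_neg (by omega)]; omega
    rw [h3]
    simp only [List.append_assoc, List.cons_append, List.nil_append] at h1 h2 ⊢
    linarith
  · have h1 := hf.append_one hd (x ++ y)
    have h3 : succLetter d (ω k) = 1 := by rw [succLetter, if_pos hk]
    rw [h3]
    simp only [List.append_assoc, List.cons_append, List.nil_append] at h1 ⊢
    linarith

theorem prefixDerives_succ_of_eq_append (hd : 3 ≤ d) (hω : IsSigmaFixedPoint d ω) {m k : ℕ}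
    (hk : ω k ≠ d - 1) (h1 : ω (k + 1) = 1)
    (h : pref ω m = applySub (sig d) (pref ω (k + 1)) ++ [1]) :
    PrefixDerives d ω m (k + 2) := by
  intro f hf x
  obtain ⟨y, hy⟩ := applySub_append_singleton hd (pref ω k) (ω k)
  have h2 := hf.append_one_of_ne hd hω (x ++ y) (e := succLetter d (ω k))
    (by unfold succLetter; split_ifs <;> omega)
  have h3 := hf.append_two_eq_zero hd (x ++ y ++ [succLetter d (ω k)] ++ [1]) (a := 2) (by simp)
  have h4 : sig d 1 = [1, 2] := by simp [sig]
  rw [h, pref_succ ω (k + 1), h1, applySub_append _ (pref ω (k + 1)), applySub_singleton, h4,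
    pref_succ, hy]
  simp only [List.append_assoc, List.cons_append, List.nil_append] at h2 h3 ⊢
  linarith

theorem exists_prefixDerives (hd : 3 ≤ d) (hω : IsSigmaFixedPoint d ω) {m : ℕ} (hm : 2 ≤ m) :
    ∃ q, 1 ≤ q ∧ q < m ∧ PrefixDerives d ω m q ∧
      (PrefixDerives d ω (m + 1) q ∨ PrefixDerives d ω (m + 1) (q + 1)) := by
  obtain ⟨k, ⟨hk, h⟩ | ⟨hk, h1, h2, h⟩⟩ := hω.exists_block_succ hm
  · have hadj := hω.adjPair hd k
    have hone : ω (k + 1) = 1 →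
        pref ω (m + 1) = applySub (sig d) (pref ω (k + 1)) ++ [1] := fun h1 => by
      rw [pref_succ, h, (hω.block_of_eq_one h h1).1]
    by_cases hcd : ω k = d
    · have h1 : ω (k + 1) = 1 := by unfold AdjPair at hadj; omega
      obtain ⟨k, rfl⟩ : ∃ j, k = j + 1 :=
        Nat.exists_eq_succ_of_ne_zero (by rintro rfl; rw [hω.zero] at hcd; omega)
      have hm' : pref ω m = applySub (sig d) (pref ω (k + 1)) ++ [1] := by
        rw [h, pref_succ, hcd, applySub_append, applySub_singleton, sig_of_ne_one (by omega),
          succLetter, if_pos rfl]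
      have hadj' := hω.adjPair hd k
      exact ⟨k + 1, by omega, by omega,
        prefixDerives_of_eq_append hd (by unfold AdjPair at hadj'; omega) hm',
        Or.inr (prefixDerives_of_eq_append hd (Or.inr hcd) (hone h1))⟩
    refine ⟨k + 1, by omega, hk, prefixDerives_of_eq hd hω hcd h, ?_⟩
    by_cases hcd1 : ω k = d - 1
    · refine Or.inl (prefixDerives_of_eq_append hd (Or.inl hcd1) ?_)
      by_cases h1 : ω (k + 1) = 1
      · exact hone h1
      · rw [pref_succ, h, hω.block_of_ne_one h h1, succLetter, if_pos]
        unfold AdjPair at hadj; omega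
    · refine Or.inr ?_
      by_cases h1 : ω (k + 1) = 1
      · exact prefixDerives_succ_of_eq_append hd hω hcd1 h1 (hone h1)
      · refine prefixDerives_of_eq hd hω (by unfold AdjPair at hadj; omega) ?_
        rw [pref_succ, h, pref_succ ω (k + 1), applySub_append, applySub_singleton,
          sig_of_ne_one h1, hω.block_of_ne_one h h1]
  · have hs : PrefixDerives d ω (m + 1) (k + 2) := by
      refine prefixDerives_of_eq hd hω (by omega) ?_
      rw [pref_succ, h, h2, pref_succ ω (k + 1), applySub_append, applySub_singleton, h1]
      simp [sig]
    by_cases hcd1 : ω k = d - 1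
    · exact ⟨k + 1, by omega, by omega, prefixDerives_of_eq_append hd (Or.inl hcd1) h, Or.inr hs⟩
    · exact ⟨k + 2, by omega, hk, prefixDerives_succ_of_eq_append hd hω hcd1 h1 h, Or.inl hs⟩

theorem PrefixDerives.apply (hd : 3 ≤ d) (hω : IsSigmaFixedPoint d ω) {m q : ℕ}
    (h : PrefixDerives d ω m q) {f : List ℕ → ℝ} (hf : ConsistentWeight d f) :
    f (pref ω m) = derivedWeight d f (pref ω q) := by
  have := h f hf []
  rw [derivedWeight, if_neg (hω.pref_zero_notMem hd q)]
  simpa using this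

theorem PrefixDerives.apply_cons (hd : 3 ≤ d) (hω : IsSigmaFixedPoint d ω) {m q a : ℕ}
    (h : PrefixDerives d ω m q) {f : List ℕ → ℝ} (hf : ConsistentWeight d f) (ha : 1 ≤ a) :
    f (succLetter d a :: pref ω m) = derivedWeight d f (a :: pref ω q) := by
  have h0 := hω.pref_zero_notMem hd q
  rw [hf.succLetter_cons hd, h f hf, derivedWeight, if_neg (by simp [h0]; omega)]
  rfl

theorem exists_prefix_exponent (hd : 3 ≤ d) (hω : IsSigmaFixedPoint d ω) {r : ℝ} (h0 : 0 < r)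
    (hr : r + r ^ d = 1) (m : ℕ) (hm : 1 ≤ m) : ∃ g : ℕ, ∀ f, ConsistentWeight d f →
      f (pref ω m) = f [] * r ^ g ∧
      (∀ a, 1 ≤ a → a ≤ d → ∃ k, d - 1 ≤ k ∧ k ≤ 2 * d - 2 ∧
        f (a :: pref ω m) = f [] * r ^ (g + k)) ∧
      (∀ k, d - 1 ≤ k → k ≤ 2 * d - 2 → ∃ a, 1 ≤ a ∧ a ≤ d ∧
        f (a :: pref ω m) = f [] * r ^ (g + k)) ∧
      (f (pref ω (m + 1)) = f [] * r ^ g ∨ f (pref ω (m + 1)) = f [] * r ^ (g + 1)) := by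
  induction m using Nat.strong_induction_on with
  | _ m ih =>
  rcases hm.eq_or_lt with rfl | hm
  · have hp1 : pref ω 1 = [1] := by rw [pref_succ, hω.zero]; rfl
    have hp2 : pref ω 2 = [1, 2] := by rw [pref_succ, hp1, hω.one]; rfl
    refine ⟨d - 1, fun f hf => ?_⟩
    rw [hp1, hp2]
    have hlet : ∀ a, 1 ≤ a → a ≤ d → f [a] = f [] * r ^ (d - 1 + (a - 1)) := fun a h1 h2 => by
      obtain ⟨b, rfl⟩ := Nat.exists_eq_add_of_le' h1
      exact hf.letter_eq hd h0 hr (by omega)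
    have hlast : f [d, 1] = f [] * r ^ (d - 1 + (d - 1)) := by
      rw [← hlet d (by omega) le_rfl]
      exact (hf.append_last hd []).symm
    have hcons : ∀ a, 1 ≤ a → a < d → f [a, 1] = f [] * r ^ (d - 1 + (a + d - 1)) := by
      intro a h1 h2
      have h3 : f [a] = f [a, 1] + f [a, a + 1] := by
        rw [hf.right, ← Finset.sum_subset (s₁ := {1, a + 1})]
        · rw [Finset.sum_pair (by omega)]
          rfl
        · intro b hb
          simp at hb ⊢
          omega
        · intro b _ hb
          refine hf.eq_zero fun h => hb ?_
          have := Lang.adjPair hd [] [] h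
          unfold AdjPair at this
          simp
          omega
      have h4 : f [a + 1] = f [a, a + 1] := by
        refine hf.eq_cons (by omega) fun b hb h => ?_
        have := Lang.adjPair hd [] [] h
        unfold AdjPair at this
        omega
      have h5 : f [a, 1] = f [a] - f [a + 1] := by linarith
      rw [h5, hlet a h1 h2.le, hlet (a + 1) (by omega) h2,
        show d - 1 + (a + 1 - 1) = d - 1 + (a - 1) + 1 by omega,
        show d - 1 + (a + d - 1) = d - 1 + (a - 1) + d by omega, pow_succ, pow_add _ _ d,
        show r ^ d = 1 - r by linarith]
      ring
    refine ⟨by simpa using hlet 1 le_rfl (by omega), fun a h1 h2 => ?_, fun k h1 h2 => ?_,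
      Or.inr ?_⟩
    · rcases h2.eq_or_lt with rfl | h2
      · exact ⟨a - 1, by omega, by omega, hlast⟩
      · exact ⟨a + d - 1, by omega, by omega, hcons a h1 h2⟩
    · rcases h1.eq_or_lt with rfl | h1
      · exact ⟨d, by omega, le_rfl, hlast⟩
      · refine ⟨k + 1 - d, by omega, by omega, ?_⟩
        rw [hcons _ (by omega) (by omega)]
        congr 3
        omega
    · rw [← hf.two_cons hd, hlet 2 (by omega) (by omega)]
  · obtain ⟨q, hq1, hqm, hD, hD'⟩ := exists_prefixDerives hd hω hm
    obtain ⟨g, hg⟩ := ih q hqm hq1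
    refine ⟨g + 1, fun f hf => ?_⟩
    obtain ⟨e1, e2, e3, e4⟩ := hg _ (hf.derived hd)
    rw [hf.derivedWeight_nil hd h0 hr] at *
    have hp : ∀ n, f [] * r * r ^ n = f [] * r ^ (n + 1) := fun n => by ring
    refine ⟨by rw [hD.apply hd hω hf, e1, hp], fun a h1 h2 => ?_, fun k h1 h2 => ?_, ?_⟩
    · obtain ⟨k, h3, h4, h5⟩ := e2 (predLetter d a)
        (by unfold predLetter; split_ifs <;> omega) (by unfold predLetter; split_ifs <;> omega)
      refine ⟨k, h3, h4, ?_⟩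
      have h6 : succLetter d (predLetter d a) = a := by
        unfold succLetter predLetter; split_ifs <;> omega
      rw [← h6, hD.apply_cons hd hω hf (by unfold predLetter; split_ifs <;> omega), h5, hp]
      congr 2
      omega
    · obtain ⟨a, h3, h4, h5⟩ := e3 k h1 h2
      refine ⟨succLetter d a, by unfold succLetter; split_ifs <;> omega,
        by unfold succLetter; split_ifs <;> omega, ?_⟩
      rw [hD.apply_cons hd hω hf h3, h5, hp]
      congr 2
      omega
    · rcases hD' with hD' | hD'
      · rw [hD'.apply hd hω hf, e1, hp]
        exact Or.inl rfl
      · rw [hD'.apply hd hω hf, ← hp, ← hp]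
        exact e4

end PrefixDerives

/-! ### Recurrence of prefixes and the values of a weight -/

theorem sigIter_two {d k : ℕ} (hk : k + 2 ≤ d) : sigIter d k [2] = [k + 2] := by
  induction k with
  | zero => rfl
  | succ k ih =>
    rw [sigIter_succ, ih (by omega), applySub_singleton, sig_of_ne_one (by omega), succLetter,
      if_neg (by omega)]

theorem sigIter_add_one {d : ℕ} (hd : 3 ≤ d) (n : ℕ) :
    sigIter d (n + d) [1] = sigIter d (n + (d - 1)) [1] ++ sigIter d n [1] := by
  have h : sigIter d (d - 1) [2] = [1] := by
    rw [show d - 1 = d - 2 + 1 by omega, sigIter_succ, sigIter_two (by omega),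
      applySub_singleton, sig_of_ne_one (by omega), succLetter, if_pos (by omega)]
  rw [show n + d = n + (d - 1) + 1 by omega, sigIter_succ_one]
  congr 1
  rw [← h]
  simp only [sigIter, ← Function.iterate_add_apply]

theorem fac_eq_pref_of_le {ω : ℕ → ℕ} {j m l : ℕ} (h : fac ω j l = pref ω l) (hm : m ≤ l) :
    fac ω j m = pref ω m := by
  obtain ⟨k, rfl⟩ := Nat.exists_eq_add_of_le hm
  rw [← fac_zero_left, fac_add, fac_add] at h
  rw [← fac_zero_left]
  exact List.append_inj_left h (by simp)

/-- Every prefix of `ω` occurs in `ω` at arbitrarily large positions. -/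
theorem IsSigmaFixedPoint.exists_fac_eq_pref {d : ℕ} {ω : ℕ → ℕ} (hd : 3 ≤ d)
    (hω : IsSigmaFixedPoint d ω) (i m : ℕ) : ∃ j, i < j ∧ fac ω j m = pref ω m := by
  have h := hω.sigIter_eq (i + m + d)
  have h1 := lt_length_sigIter_one d (i + m + (d - 1))
  have h2 := lt_length_sigIter_one d (i + m)
  refine ⟨(sigIter d (i + m + (d - 1)) [1]).length, by omega,
    fac_eq_pref_of_le (l := (sigIter d (i + m) [1]).length) ?_ (by omega)⟩
  rw [sigIter_add_one hd, ← fac_zero_left, List.length_append, fac_add, zero_add] at h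
  rw [← hω.sigIter_eq]
  exact (List.append_inj_right h (by simp)).symm

theorem exists_eq_of_step {h : ℕ → ℕ} {s t i : ℕ} (hst : s ≤ t)
    (hstep : ∀ m, s ≤ m → h (m + 1) ≤ h m + 1) (hs : h s ≤ i) (ht : i ≤ h t) :
    ∃ m, s ≤ m ∧ h m = i := by
  induction t, hst using Nat.le_induction with
  | base => exact ⟨s, le_rfl, by omega⟩
  | succ t hst ih =>
    by_cases h1 : i ≤ h t
    · exact ih h1
    · exact ⟨t + 1, by omega, by have := hstep t hst; omega⟩

namespace ConsistentWeight

variable {d : ℕ} {ω : ℕ → ℕ} {f : List ℕ → ℝ}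

theorem append_right_le (hd : 3 ≤ d) (hf : ConsistentWeight d f) (u v : List ℕ) :
    f (u ++ v) ≤ f u := by
  induction v using List.reverseRecOn with
  | nil => simp
  | append_singleton v a ih =>
    rw [← List.append_assoc]
    by_cases h : Lang d (u ++ v ++ [a])
    · exact (hf.append_le (h.bounds hd a (by simp)) _).trans ih
    · rw [hf.eq_zero h]
      exact hf.nonneg _

theorem append_left_le (hd : 3 ≤ d) (hf : ConsistentWeight d f) (u v : List ℕ) :
    f (v ++ u) ≤ f u := by
  induction v with
  | nil => simp
  | cons a v ih =>
    rw [List.cons_append]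
    by_cases h : Lang d (a :: (v ++ u))
    · exact (hf.cons_le (h.bounds hd a (by simp)) _).trans ih
    · rw [hf.eq_zero h]
      exact hf.nonneg _

theorem fac_succ_cons_eq (hd : 3 ≤ d) (hω : IsSigmaFixedPoint d ω) (hf : ConsistentWeight d f)
    {i n : ℕ} (h : fac ω (i + 1) n ≠ pref ω n) : f (fac ω i (n + 1)) = f (fac ω (i + 1) n) := by
  have hl := hω.lang_fac i (n + 1)
  rw [fac_succ_cons] at hl ⊢
  refine (hf.eq_cons (hω.bounds hd i) fun a ha h' => h ?_).symm
  simpa using hω.eq_pref_of_leftSpecial hd ha _ h' hl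

theorem exists_fac_eq_pref (hd : 3 ≤ d) (hω : IsSigmaFixedPoint d ω)
    (hf : ConsistentWeight d f) (i n : ℕ) : ∃ m, n ≤ m ∧ f (fac ω i n) = f (pref ω m) := by
  induction i generalizing n with
  | zero => exact ⟨n, le_rfl, by rw [fac_zero_left]⟩
  | succ i ih =>
    by_cases h : fac ω (i + 1) n = pref ω n
    · exact ⟨n, le_rfl, by rw [h]⟩
    · obtain ⟨m, hm, h'⟩ := ih (n + 1)
      exact ⟨m, by omega, by rw [← h', hf.fac_succ_cons_eq hd hω h]⟩

theorem fac_eq_pref (hd : 3 ≤ d) (hω : IsSigmaFixedPoint d ω) (hf : ConsistentWeight d f)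
    {m n : ℕ} (h : ∀ a, 1 ≤ a → a ≤ d → f (a :: pref ω n) < f (pref ω m)) {j k : ℕ}
    (hjk : j + k = m) (hk : n ≤ k) : f (fac ω j k) = f (pref ω m) := by
  induction j generalizing k with
  | zero => rw [fac_zero_left, ← hjk, zero_add]
  | succ j ih =>
    have h1 := ih (k := k + 1) (by omega) (by omega)
    rw [← h1]
    refine (hf.fac_succ_cons_eq hd hω fun h2 => ?_).symm
    obtain ⟨t, ht⟩ := pref_prefix ω hk
    rw [fac_succ_cons, h2, ← ht, ← List.cons_append] at h1
    have h3 := hf.append_right_le hd (ω j :: pref ω n) t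
    have h4 := h (ω j) (hω.bounds hd j).1 (hω.bounds hd j).2
    linarith

theorem exists_cons_pref_le_fac (hd : 3 ≤ d) (hω : IsSigmaFixedPoint d ω)
    (hf : ConsistentWeight d f) (i n : ℕ) :
    ∃ a, 1 ≤ a ∧ a ≤ d ∧ f (a :: pref ω n) ≤ f (fac ω i (n + 1)) := by
  obtain ⟨j, hij, hj⟩ := hω.exists_fac_eq_pref hd i n
  obtain ⟨k, rfl⟩ := Nat.exists_eq_add_of_lt hij
  clear hij
  induction k generalizing i with
  | zero =>
    refine ⟨ω i, (hω.bounds hd i).1, (hω.bounds hd i).2, ?_⟩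
    rw [fac_succ_cons, ← hj]
  | succ k ih =>
    by_cases h : fac ω (i + 1) n = pref ω n
    · refine ⟨ω i, (hω.bounds hd i).1, (hω.bounds hd i).2, ?_⟩
      rw [fac_succ_cons, h]
    · obtain ⟨a, h1, h2, h3⟩ := ih (i + 1) (by rw [← hj]; congr 1; ring)
      refine ⟨a, h1, h2, h3.trans ?_⟩
      rw [hf.fac_succ_cons_eq hd hω h, fac_succ]
      exact hf.append_right_le hd _ _

theorem values_one (hd : 3 ≤ d) {r : ℝ} (h0 : 0 < r) (hr : r + r ^ d = 1)
    (hf : ConsistentWeight d f) (hnil : f [] = 1) (x : ℝ) :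
    (∃ u, Lang d u ∧ u.length = 1 ∧ f u = x) ↔ ∃ k, k ≤ d - 1 ∧ x = r ^ (d - 1 + k) := by
  constructor
  · rintro ⟨u, hu, hlen, rfl⟩
    obtain ⟨a, rfl⟩ := List.length_eq_one_iff.1 hlen
    have hb := hu.bounds hd a (by simp)
    obtain ⟨k, rfl⟩ := Nat.exists_eq_add_of_le' hb.1
    exact ⟨k, by omega, by rw [hf.letter_eq hd h0 hr (by omega), hnil, one_mul]⟩
  · rintro ⟨k, hk, rfl⟩
    have h := hf.letter_eq hd h0 hr (j := k) (by omega)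
    rw [hnil, one_mul] at h
    exact ⟨[k + 1], hf.lang _ (h ▸ (pow_pos h0 _).ne'), rfl, h⟩

theorem values_succ (hd : 3 ≤ d) (hω : IsSigmaFixedPoint d ω) {r : ℝ} (h0 : 0 < r)
    (hr : r + r ^ d = 1) (hf : ConsistentWeight d f) (hnil : f [] = 1) {n : ℕ} (hn : 1 ≤ n) :
    ∃ a b, f (pref ω n) = r ^ a ∧ f (pref ω (n + 1)) = r ^ b ∧ (b = a ∨ b = a + 1) ∧
      ∀ x, (∃ u, Lang d u ∧ u.length = n + 1 ∧ f u = x) ↔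
        ∃ i, b ≤ i ∧ i ≤ a + (2 * d - 2) ∧ x = r ^ i := by
  have hr1 : r < 1 := by linarith [pow_pos h0 d]
  have hle : ∀ {i j : ℕ}, r ^ i ≤ r ^ j ↔ j ≤ i := pow_le_pow_iff_right_of_lt_one₀ h0 hr1
  have hlt : ∀ {i j : ℕ}, r ^ i < r ^ j ↔ j < i := pow_lt_pow_iff_right_of_lt_one₀ h0 hr1
  have hinj : ∀ {i j : ℕ}, r ^ i = r ^ j → i = j := fun h =>
    le_antisymm (hle.1 h.ge) (hle.1 h.le)
  have hex : ∀ m, ∃ g : ℕ, 1 ≤ m → f (pref ω m) = r ^ g ∧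
      (∀ a, 1 ≤ a → a ≤ d → ∃ k, d - 1 ≤ k ∧ k ≤ 2 * d - 2 ∧ f (a :: pref ω m) = r ^ (g + k)) ∧
      (∀ k, d - 1 ≤ k → k ≤ 2 * d - 2 → ∃ a, 1 ≤ a ∧ a ≤ d ∧
        f (a :: pref ω m) = r ^ (g + k)) ∧
      (f (pref ω (m + 1)) = r ^ g ∨ f (pref ω (m + 1)) = r ^ (g + 1)) := fun m => by
    by_cases hm : 1 ≤ m
    · obtain ⟨g, hg⟩ := exists_prefix_exponent hd hω h0 hr m hm
      have := hg f hf
      simp only [hnil, one_mul] at this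
      exact ⟨g, fun _ => this⟩
    · exact ⟨0, fun h => absurd h hm⟩
  choose g hg using hex
  have hpref : ∀ m, 1 ≤ m → f (pref ω m) = r ^ g m := fun m hm => (hg m hm).1
  have hstep : ∀ m, 1 ≤ m → g (m + 1) = g m ∨ g (m + 1) = g m + 1 := fun m hm => by
    have h := (hg m hm).2.2.2
    rw [hpref (m + 1) (by omega)] at h
    exact h.imp hinj hinj
  refine ⟨g n, g (n + 1), hpref n hn, hpref _ (by omega), hstep n hn, fun x => ⟨?_, ?_⟩⟩
  · rintro ⟨u, hu, hlen, rfl⟩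
    obtain ⟨i, hi⟩ := (hω.lang_iff u).1 hu
    rw [hlen] at hi
    rw [hi]
    obtain ⟨m, hm, h1⟩ := hf.exists_fac_eq_pref hd hω i (n + 1)
    obtain ⟨a, ha, had, h2⟩ := hf.exists_cons_pref_le_fac hd hω i n
    obtain ⟨k, -, hk, h3⟩ := (hg n hn).2.1 a ha had
    rw [hpref m (by omega)] at h1
    rw [h1, h3, hle] at h2
    refine ⟨g m, ?_, by omega, h1⟩
    rw [← hle, ← hpref m (by omega), ← hpref (n + 1) (by omega)]
    obtain ⟨t, ht⟩ := pref_prefix ω hm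
    rw [← ht]
    exact hf.append_right_le hd _ _
  · rintro ⟨i, hi, hi', rfl⟩
    by_cases hid : g n + (d - 1) ≤ i
    · obtain ⟨a, -, -, h⟩ := (hg n hn).2.2.1 (i - g n) (by omega) (by omega)
      rw [show g n + (i - g n) = i by omega] at h
      exact ⟨_, hf.lang _ (h ▸ (pow_pos h0 _).ne'), by simp, h⟩
    · obtain ⟨a, -, -, h⟩ := (hg n hn).2.2.1 (d - 1) le_rfl (by omega)
      obtain ⟨s, hs⟩ := (hω.lang_iff _).1 (hf.lang _ (h ▸ (pow_pos h0 _).ne'))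
      rw [List.length_cons, length_pref] at hs
      have h1 := hf.append_left_le hd (fac ω s (n + 1)) (fac ω 0 s)
      have h2 := fac_add ω 0 s (n + 1)
      rw [zero_add] at h2
      rw [← h2, fac_zero_left, ← hs, h, hpref _ (by omega), hle] at h1
      obtain ⟨m, hm, hmi⟩ := exists_eq_of_step (h := g) (s := n + 1) (t := s + (n + 1))
        (by omega) (fun m hm => by have := hstep m (by omega); omega) hi (by omega)
      refine ⟨fac ω (m - (n + 1)) (n + 1), hω.lang_fac _ _, by simp, ?_⟩
      rw [← hmi, ← hpref m (by omega)]
      refine hf.fac_eq_pref hd hω (n := n) (fun a h1 h2 => ?_) (by omega) (by omega)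
      obtain ⟨k, hk, -, h3⟩ := (hg n hn).2.1 a h1 h2
      rw [h3, hpref m (by omega), hlt]
      omega

theorem pref_succ_lt (hd : 3 ≤ d) (hω : IsSigmaFixedPoint d ω) (hf : ConsistentWeight d f)
    (hpos : ∀ u, Lang d u → 0 < f u) {n : ℕ} (h : RightSpecial d (pref ω n)) :
    f (pref ω (n + 1)) < f (pref ω n) := by
  obtain ⟨b, hb, hbω, hb'⟩ : ∃ b, (1 ≤ b ∧ b ≤ d) ∧ b ≠ ω n ∧ Lang d (pref ω n ++ [b]) := by
    obtain ⟨a, b, hab, ha1, ha2, hb1, hb2, ha, hb⟩ := h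
    by_cases h' : a = ω n
    · exact ⟨b, ⟨hb1, hb2⟩, fun h => hab (h'.trans h.symm), hb⟩
    · exact ⟨a, ⟨ha1, ha2⟩, h', ha⟩
  have h1 := hpos _ hb'
  rw [pref_succ, hf.right (pref ω n)]
  exact Finset.single_lt_sum (f := fun a => f (pref ω n ++ [a])) hbω
    (Finset.mem_Icc.2 (hω.bounds hd n)) (Finset.mem_Icc.2 hb) h1 fun a _ _ => hf.nonneg _

theorem pref_succ_eq (hd : 3 ≤ d) (hω : IsSigmaFixedPoint d ω) (hf : ConsistentWeight d f)
    {n : ℕ} (h : ¬ RightSpecial d (pref ω n)) : f (pref ω (n + 1)) = f (pref ω n) := by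
  have hb := hω.bounds hd n
  have hl := hω.lang_pref (n + 1)
  rw [pref_succ] at hl ⊢
  refine (hf.eq_append hb fun a ha h' => h ?_).symm
  have ha' := h'.bounds hd a (by simp)
  exact ⟨a, ω n, ha, ha'.1, ha'.2, hb.1, hb.2, h', hl⟩

end ConsistentWeight

/-! ### The weight attached to an invariant measure -/

section Measure

variable {d : ℕ} {ω : ℕ → ℕ}

theorem iterate_shiftMap (V : ℕ → ℕ) (n : ℕ) : shiftMap^[n] V = fun j => V (n + j) := by
  induction n generalizing V with
  | zero => simp
  | succ n ih =>
    rw [Function.iterate_succ_apply, ih]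
    funext j
    simp only [shiftMap]
    congr 1
    ring

theorem continuous_shiftMap : Continuous shiftMap :=
  continuous_pi fun i => continuous_apply (i + 1)

theorem isClopen_prefixOfInf (u : List ℕ) : IsClopen {V | PrefixOfInf u V} := by
  have h : {V | PrefixOfInf u V} = ⋂ i : Fin u.length, {V | u.get i = V i} := by
    ext V
    simp only [Set.mem_ofPred_eq, Set.mem_iInter]
    exact ⟨fun h i => h i i.2, fun h i hi => h ⟨i, hi⟩⟩
  rw [h]
  exact isClopen_iInter_of_finite fun i =>
    (isClopen_discrete {a | u.get i = a}).preimage (continuous_apply _)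

theorem measurableSet_cyl (ω : ℕ → ℕ) (u : List ℕ) : MeasurableSet (Cyl ω u) :=
  (isClosed_closure.inter (isClopen_prefixOfInf u).isClosed).measurableSet

theorem cyl_nil (ω : ℕ → ℕ) : Cyl ω [] = OmegaPlus ω := by
  ext V
  simp [Cyl, PrefixOfInf]

theorem lang_of_prefixOfInf (hω : IsSigmaFixedPoint d ω) {V : ℕ → ℕ} (hV : V ∈ OmegaPlus ω)
    {u : List ℕ} (hu : PrefixOfInf u V) : Lang d u := by
  obtain ⟨W, hW, n, rfl⟩ := mem_closure_iff.1 hV _ (isClopen_prefixOfInf u).isOpen hu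
  rw [iterate_shiftMap] at hW
  exact (hω.lang_iff u).2 ⟨n, (prefixOfInf_shift_iff n).1 hW⟩

theorem bounds_of_mem_omegaPlus (hd : 3 ≤ d) (hω : IsSigmaFixedPoint d ω) {V : ℕ → ℕ}
    (hV : V ∈ OmegaPlus ω) (n : ℕ) : 1 ≤ V n ∧ V n ≤ d := by
  have h : Lang d (pref V (n + 1)) :=
    lang_of_prefixOfInf hω hV (prefixOfInf_iff.2 (by rw [length_pref]))
  exact h.bounds hd _ (by rw [pref_succ]; simp)

theorem shiftMap_mem_omegaPlus {V : ℕ → ℕ} (hV : V ∈ OmegaPlus ω) :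
    shiftMap V ∈ OmegaPlus ω := by
  refine map_mem_closure continuous_shiftMap hV ?_
  rintro _ ⟨n, rfl⟩
  exact ⟨n + 1, (Function.iterate_succ_apply' _ _ _).symm⟩

theorem prefixOfInf_append_singleton {u : List ℕ} {a : ℕ} {V : ℕ → ℕ} :
    PrefixOfInf (u ++ [a]) V ↔ PrefixOfInf u V ∧ a = V u.length := by
  rw [prefixOfInf_iff, prefixOfInf_iff, List.length_append, List.length_singleton, pref_succ,
    List.append_singleton_inj]

theorem prefixOfInf_cons {u : List ℕ} {a : ℕ} {V : ℕ → ℕ} :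
    PrefixOfInf (a :: u) V ↔ a = V 0 ∧ PrefixOfInf u (shiftMap V) := by
  rw [show shiftMap V = fun j => V (1 + j) by funext j; rw [add_comm]; rfl,
    prefixOfInf_shift_iff, prefixOfInf_iff, List.length_cons, ← fac_zero_left, fac_succ_cons,
    zero_add, List.cons_eq_cons]

theorem cyl_eq_biUnion_append (hd : 3 ≤ d) (hω : IsSigmaFixedPoint d ω) (u : List ℕ) :
    Cyl ω u = ⋃ a ∈ Finset.Icc 1 d, Cyl ω (u ++ [a]) := by
  ext V
  simp only [Cyl, Set.mem_ofPred_eq, Set.mem_iUnion, prefixOfInf_append_singleton, Finset.mem_Icc]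
  constructor
  · rintro ⟨hV, hu⟩
    exact ⟨V u.length, bounds_of_mem_omegaPlus hd hω hV _, hV, hu, rfl⟩
  · rintro ⟨_, _, hV, hu, _⟩
    exact ⟨hV, hu⟩

theorem preimage_shiftMap_cyl (hd : 3 ≤ d) (hω : IsSigmaFixedPoint d ω) (u : List ℕ) :
    shiftMap ⁻¹' Cyl ω u ∩ OmegaPlus ω = ⋃ a ∈ Finset.Icc 1 d, Cyl ω (a :: u) := by
  ext V
  simp only [Cyl, Set.mem_ofPred_eq, Set.mem_iUnion, prefixOfInf_cons, Finset.mem_Icc,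
    Set.mem_inter_iff, Set.mem_preimage]
  constructor
  · rintro ⟨⟨_, hu⟩, hV⟩
    exact ⟨V 0, bounds_of_mem_omegaPlus hd hω hV _, hV, rfl, hu⟩
  · rintro ⟨_, _, hV, _, hu⟩
    exact ⟨⟨shiftMap_mem_omegaPlus hV, hu⟩, hV⟩

open MeasureTheory in
theorem consistentWeight_measure (hd : 3 ≤ d) (hω : IsSigmaFixedPoint d ω)
    (μ : Measure (ℕ → ℕ)) [IsProbabilityMeasure μ]
    (hinv : ∀ B : Set (ℕ → ℕ), MeasurableSet B → B ⊆ OmegaPlus ω →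
      μ (shiftMap ⁻¹' B ∩ OmegaPlus ω) = μ B) :
    ConsistentWeight d fun u => (μ (Cyl ω u)).toReal where
  nonneg u := ENNReal.toReal_nonneg
  lang u hu := by
    obtain ⟨V, hV, h⟩ : (Cyl ω u).Nonempty := by
      rw [Set.nonempty_iff_ne_empty]
      intro h
      simp [h] at hu
    exact lang_of_prefixOfInf hω hV h
  right u := by
    rw [cyl_eq_biUnion_append hd hω u]
    refine measureReal_biUnion_finset (fun a _ b _ hab => ?_) fun a _ => measurableSet_cyl ω _
    refine Set.disjoint_left.2 fun V ha hb => hab ?_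
    exact (prefixOfInf_append_singleton.1 ha.2).2.trans
      (prefixOfInf_append_singleton.1 hb.2).2.symm
  left u := by
    rw [← hinv _ (measurableSet_cyl ω u) fun V hV => hV.1, preimage_shiftMap_cyl hd hω u]
    refine measureReal_biUnion_finset (fun a _ b _ hab => ?_) fun a _ => measurableSet_cyl ω _
    refine Set.disjoint_left.2 fun V ha hb => hab ?_
    exact (prefixOfInf_cons.1 ha.2).1.trans (prefixOfInf_cons.1 hb.2).1.symm

end Measure

open MeasureTheory in
/-- For a shift-invariant Borel probability measure μ on Ω⁺:
(i) E_1 = {λ^{−(d−1+k)} : 0 ≤ k ≤ d−1};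
(ii) for n ≥ 2, if the prefix of ω of length n−1 is right-special then
E_n = {λ^{−(j+k)} : 0 ≤ k ≤ 2d−3} for some j ∈ ℕ, and otherwise
E_n = {λ^{−(j+k)} : 0 ≤ k ≤ 2d−2} for some j ∈ ℕ. -/
theorem stmt_16 (d : ℕ) (hd : 3 ≤ d) (ω : ℕ → ℕ) (hω : IsSigmaFixedPoint d ω)
    (μ : Measure (ℕ → ℕ)) [IsProbabilityMeasure μ]
    (hμΩ : μ (OmegaPlus ω) = 1)
    (hinv : ∀ B : Set (ℕ → ℕ), MeasurableSet B → B ⊆ OmegaPlus ω →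
      μ (shiftMap ⁻¹' B ∩ OmegaPlus ω) = μ B)
    (lam : ℝ) (hlam1 : 1 < lam) (hlam : lam ^ d = lam ^ (d - 1) + 1) :
    cylValues ω μ d 1 =
      {x : ℝ | ∃ k : ℕ, k ≤ d - 1 ∧ x = lam ^ (-((d - 1 + k : ℕ) : ℤ))} ∧
    ∀ n : ℕ, 2 ≤ n →
      (RightSpecial d ((List.range (n - 1)).map ω) →
        ∃ j : ℕ, cylValues ω μ d n =
          {x : ℝ | ∃ k : ℕ, k ≤ 2 * d - 3 ∧ x = lam ^ (-((j + k : ℕ) : ℤ))}) ∧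
      (¬ RightSpecial d ((List.range (n - 1)).map ω) →
        ∃ j : ℕ, cylValues ω μ d n =
          {x : ℝ | ∃ k : ℕ, k ≤ 2 * d - 2 ∧ x = lam ^ (-((j + k : ℕ) : ℤ))}) := by
  have h0 : 0 < lam⁻¹ := inv_pos.2 (by linarith)
  have hr : lam⁻¹ + lam⁻¹ ^ d = 1 := by
    have hpos : 0 < lam := by linarith
    obtain ⟨e, rfl⟩ := Nat.exists_eq_add_of_le' (show 1 ≤ d by omega)
    rw [Nat.add_sub_cancel, pow_succ] at hlam
    rw [pow_succ, inv_pow]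
    field_simp
    linarith
  have hzpow : ∀ i : ℕ, lam ^ (-(i : ℤ)) = lam⁻¹ ^ i := fun i => by
    rw [zpow_neg, zpow_natCast, inv_pow]
  have hr1 : lam⁻¹ < 1 := inv_lt_one_of_one_lt₀ hlam1
  have hf := consistentWeight_measure hd hω μ hinv
  have hnil : (μ (Cyl ω [])).toReal = 1 := by rw [cyl_nil, hμΩ, ENNReal.toReal_one]
  simp only [hzpow]
  refine ⟨Set.ext fun x => hf.values_one hd h0 hr hnil x, fun n hn => ?_⟩
  obtain ⟨n, rfl⟩ := Nat.exists_eq_add_of_le' (show 1 ≤ n by omega)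
  rw [Nat.add_sub_cancel]
  obtain ⟨a, b, ha, hb, hab, h⟩ := hf.values_succ hd hω h0 hr hnil (n := n) (by omega)
  have hE : cylValues ω μ d (n + 1) =
      {x : ℝ | ∃ i, b ≤ i ∧ i ≤ a + (2 * d - 2) ∧ x = lam⁻¹ ^ i} := Set.ext h
  have hset : ∀ k, b + k = a + (2 * d - 2) → cylValues ω μ d (n + 1) =
      {x : ℝ | ∃ i, i ≤ k ∧ x = lam⁻¹ ^ (b + i)} := fun k hk => by
    rw [hE]
    ext x
    constructor
    · rintro ⟨i, h1, h2, rfl⟩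
      exact ⟨i - b, by omega, by rw [Nat.add_sub_cancel' h1]⟩
    · rintro ⟨i, h1, rfl⟩
      exact ⟨b + i, by omega, by omega, rfl⟩
  constructor
  · intro hs
    have hlt := hf.pref_succ_lt hd hω (fun u hu => ?_) hs
    · rw [ha, hb, pow_lt_pow_iff_right_of_lt_one₀ h0 hr1] at hlt
      exact ⟨b, hset _ (by omega)⟩
    · obtain ⟨i, hi⟩ := (hω.lang_iff u).1 hu
      rcases Nat.eq_zero_or_pos u.length with hl | hl
      · rw [List.eq_nil_of_length_eq_zero hl, hnil]
        exact one_pos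
      · obtain ⟨m, hm, h1⟩ := hf.exists_fac_eq_pref hd hω i u.length
        obtain ⟨g, hg⟩ := exists_prefix_exponent hd hω h0 hr m (by omega)
        rw [hi, h1, (hg _ hf).1, hnil, one_mul]
        exact pow_pos h0 g
  · intro hs
    have heq := hf.pref_succ_eq hd hω hs
    rw [ha, hb] at heq
    have hab' : b = a := pow_right_injective₀ h0 hr1.ne heq
    exact ⟨b, hset _ (by omega)⟩
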